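/- arXiv:2309.00467 — 2 statements merged into one kernel-verified Lean document; each statement's English description precedes it below -/
import Mathlib

section
/- Let u,v ∈ S_n have separated descents at position k, let w ∈ S_n, and let 1≤i<n with ℓ(s_i u)<ℓ(u) (so s_i u also has maxdes ≤ k). Writing Z_{u,v}^w(t,y)=Σ_{π∈PP(u,v,w)} wt(π), one has Z_{s_i u,v}^w = −((1+βy_i)/(y_i−y_{i+1}))·Z_{u,v}^w + ((1+βy_{i+1})/(y_i−y_{i+1}))·Z_{u,v}^w|_{y_i↔y_{i+1}}. -/
open MvPolynomial

noncomputable section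

namespace BPDPuzzle

/-- `x ⊖ y = (x - y)/(1 + β·y)`. -/
def ominus {K : Type*} [Field K] (β a b : K) : K := (a - b) / (1 + β * b)

/-- A permutation of `ℕ` lying in `S_∞`, i.e. fixing all sufficiently large integers. -/
def FinPerm (w : Equiv.Perm ℕ) : Prop := ∃ N : ℕ, ∀ j, N ≤ j → w j = j

/-- A permutation of `ℕ` lying in `S_n` (0-based positions `0, …, n-1`). -/
def InSn (n : ℕ) (w : Equiv.Perm ℕ) : Prop := ∀ j, n ≤ j → w j = j

/-- Coxeter length: the number of inversions. -/
def len (w : Equiv.Perm ℕ) : ℕ := Set.ncard {p : ℕ × ℕ | p.1 < p.2 ∧ w p.2 < w p.1}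

/-- The simple transposition `s_i`, exchanging the (0-based) positions `i` and `i+1`. -/
def sTr (i : ℕ) : Equiv.Perm ℕ := Equiv.swap i (i + 1)

/-- `u` and `v` have separated descents at position `k`, i.e.
`maxdes(u) ≤ k ≤ mindes(v)` (in 0-based conventions: `u` has no descent at any
0-based position `≥ k` and `v` has no descent at any 0-based position `< k-1`). -/
def SepDesc (k : ℕ) (u v : Equiv.Perm ℕ) : Prop :=
  (∀ i, k ≤ i → u i ≤ u (i + 1)) ∧ (∀ i, i + 1 < k → v i ≤ v (i + 1))

/-- The longest element `n ⋯ 2 1` of `S_n`, extended by the identity. -/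
def revPerm (n : ℕ) : Equiv.Perm ℕ where
  toFun j := if j < n then n - 1 - j else j
  invFun j := if j < n then n - 1 - j else j
  left_inv j := by dsimp only; split_ifs <;> omega
  right_inv j := by dsimp only; split_ifs <;> omega

/-- Exchange the values of a valuation at the indices `i` and `i+1`. -/
def swapVal {K : Type*} (t : ℕ → K) (i : ℕ) : ℕ → K :=
  fun j => if j = i then t (i + 1) else if j = i + 1 then t i else t j

/-- The defining properties of the family of double Grothendieck polynomials
`𝔊_w(x, t)`, viewed as a family of polynomials in the `x`-variables depending on
a valuation `t` of the second set of variables:  the initial condition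
`𝔊_{n⋯21}(x,t) = ∏_{i+j≤n} (x_i ⊖ t_j)` together with the Demazure recursion
`π_i 𝔊_w = 𝔊_{w s_i}` whenever `w(i) > w(i+1)` (the latter written with the
denominator `x_i - x_{i+1}` cleared). -/
def GrothFamily {K : Type*} [Field K] (β : K)
    (G : (ℕ → K) → Equiv.Perm ℕ → MvPolynomial ℕ K) : Prop :=
  ∀ t : ℕ → K, (∀ j, 1 + β * t j ≠ 0) →
    (∀ n : ℕ, G t (revPerm n) =
      ∏ i ∈ Finset.range n, ∏ j ∈ Finset.range (n - 1 - i),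
        C ((1 + β * t j)⁻¹) * (X i - C (t j))) ∧
    (∀ (w : Equiv.Perm ℕ) (i : ℕ), w (i + 1) < w i →
      (X i - X (i + 1)) * G t (w * sTr i) =
        (1 + C β * X (i + 1)) * G t w
          - (1 + C β * X i) * rename ⇑(Equiv.swap i (i + 1)) (G t w))

/-- The defining property of the structure constants `c_{u,v}^w(t,y)`:
`𝔊_u(x,y) · 𝔊_v(x,t) = Σ_w c_{u,v}^w(t,y) · 𝔊_w(x,t)`, the (finitely supported)
sum ranging over the permutations `w ∈ S_∞`. -/
def StructConsts {K : Type*} [Field K] (β : K)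
    (G : (ℕ → K) → Equiv.Perm ℕ → MvPolynomial ℕ K)
    (c : (ℕ → K) → (ℕ → K) → Equiv.Perm ℕ → Equiv.Perm ℕ → Equiv.Perm ℕ → K) : Prop :=
  ∀ t y : ℕ → K, (∀ j, 1 + β * t j ≠ 0) → (∀ j, 1 + β * y j ≠ 0) →
    ∀ u v : Equiv.Perm ℕ, FinPerm u → FinPerm v →
      {w : Equiv.Perm ℕ | c t y u v w ≠ 0}.Finite ∧
      (∀ w, ¬ FinPerm w → c t y u v w = 0) ∧
      G y u * G t v = ∑ᶠ w : Equiv.Perm ℕ, C (c t y u v w) * G t w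

/-! ### The lattice model / pipe puzzles -/

/-- A state of the `n × n` lattice model: labels in `{0, …, n}` on all horizontal
and vertical (half-)edges.  `sst.1 i j` is the `j`-th horizontal (half-)edge of row
`i` (`j = 0` being the left boundary and `j = n` the right boundary), and
`sst.2 i j` is the `i`-th vertical (half-)edge of column `j` (`i = 0` the top
boundary, `i = n` the bottom boundary). -/
abbrev GridState (n : ℕ) : Type :=
  (Fin n → Fin (n + 1) → Fin (n + 1)) × (Fin (n + 1) → Fin n → Fin (n + 1))

/-- The label on the north edge of the tile in row `i`, column `j`. -/
def labN {n : ℕ} (sst : GridState n) (i j : Fin n) : ℕ := (sst.2 i.castSucc j : ℕ)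
/-- The label on the east edge of the tile in row `i`, column `j`. -/
def labE {n : ℕ} (sst : GridState n) (i j : Fin n) : ℕ := (sst.1 i j.succ : ℕ)
/-- The label on the west edge of the tile in row `i`, column `j`. -/
def labW {n : ℕ} (sst : GridState n) (i j : Fin n) : ℕ := (sst.1 i j.castSucc : ℕ)
/-- The label on the south edge of the tile in row `i`, column `j`. -/
def labS {n : ℕ} (sst : GridState n) (i j : Fin n) : ℕ := (sst.2 i.succ j : ℕ)

/-- Boundary label `κ_u` on the right side (0-based row `i`, 1-based pipe labels). -/
def kappaLab (k : ℕ) (u : Equiv.Perm ℕ) (i : ℕ) : ℕ :=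
  if u⁻¹ i < k then u⁻¹ i + 1 else 0

/-- Boundary label `θ_v` on the top side (0-based column `j`, 1-based pipe labels). -/
def thetaLab (k : ℕ) (v : Equiv.Perm ℕ) (j : ℕ) : ℕ :=
  if k ≤ v⁻¹ j then v⁻¹ j + 1 else 0

/-- Boundary label `η_w` on the bottom side (0-based column `j`, 1-based pipe labels). -/
def etaLab (w : Equiv.Perm ℕ) (j : ℕ) : ℕ := w⁻¹ j + 1

/-- The boundary condition for pipe puzzles for `(u, v, w)`: left edges all `0`,
right edges `κ_u`, top edges `θ_v`, bottom edges `η_w`. -/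
def BoundaryCond (n k : ℕ) (u v w : Equiv.Perm ℕ) (sst : GridState n) : Prop :=
  (∀ i : Fin n, (sst.1 i 0 : ℕ) = 0) ∧
  (∀ i : Fin n, (sst.1 i (Fin.last n) : ℕ) = kappaLab k u (i : ℕ)) ∧
  (∀ j : Fin n, (sst.2 0 j : ℕ) = thetaLab k v (j : ℕ)) ∧
  (∀ j : Fin n, (sst.2 (Fin.last n) j : ℕ) = etaLab w (j : ℕ))

/-- The admissible local configurations (tiles) of a pipe puzzle, in terms of the
four edge labels `N, E, W, S` around a tile:  the empty tile, the vertical pipe,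
the horizontal pipe, the crossing (with the horizontal pipe carrying the smaller
label), the two elbows `⌟` and `⌐` (labels `≤ k` coming from the right side,
labels `> k` from the top side), and the bumping tiles (with the stated label
restrictions). -/
def LAdm (k N E W S : ℕ) : Prop :=
  (N = 0 ∧ E = 0 ∧ W = 0 ∧ S = 0) ∨
  (E = 0 ∧ W = 0 ∧ 0 < N ∧ N = S) ∨
  (N = 0 ∧ S = 0 ∧ 0 < E ∧ E = W) ∨
  (0 < E ∧ E = W ∧ E < N ∧ N = S) ∨
  (E = 0 ∧ S = 0 ∧ 0 < N ∧ N = W ∧ N ≤ k) ∨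
  (E = 0 ∧ S = 0 ∧ N = W ∧ k < N) ∨
  (N = 0 ∧ W = 0 ∧ 0 < E ∧ E = S ∧ E ≤ k) ∨
  (N = 0 ∧ W = 0 ∧ E = S ∧ k < E) ∨
  (0 < E ∧ E = S ∧ E < N ∧ N = W ∧ N ≤ k) ∨
  (k < E ∧ E = S ∧ E < N ∧ N = W) ∨
  (0 < N ∧ N = W ∧ N ≤ k ∧ E = S ∧ k < E)

/-- The admissible local configurations of a Schubert pipe puzzle (no bumping
tiles; crossings have the horizontal pipe carrying the smaller label). -/
def LAdm0 (N E W S : ℕ) : Prop :=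
  (N = 0 ∧ E = 0 ∧ W = 0 ∧ S = 0) ∨
  (E = 0 ∧ W = 0 ∧ 0 < N ∧ N = S) ∨
  (N = 0 ∧ S = 0 ∧ 0 < E ∧ E = W) ∨
  (0 < E ∧ E = W ∧ E < N ∧ N = S) ∨
  (E = 0 ∧ S = 0 ∧ 0 < N ∧ N = W) ∨
  (N = 0 ∧ W = 0 ∧ 0 < E ∧ E = S)

/-- The vertex weight `L(x; N, E, W, S)` of the lattice model (equivalently, the
weight of the corresponding pipe-puzzle tile), with spectral parameter `x`. -/
def Lwt {K : Type*} [Field K] (β : K) (k : ℕ) (x : K) (N E W S : ℕ) : K :=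
  if N = 0 ∧ E = 0 ∧ W = 0 ∧ S = 0 then x
  else if E = 0 ∧ W = 0 ∧ 0 < N ∧ N = S then 1
  else if N = 0 ∧ S = 0 ∧ 0 < E ∧ E = W then 1
  else if 0 < E ∧ E = W ∧ E < N ∧ N = S then 1
  else if E = 0 ∧ S = 0 ∧ 0 < N ∧ N = W ∧ N ≤ k then 1 + β * x
  else if E = 0 ∧ S = 0 ∧ N = W ∧ k < N then 1
  else if N = 0 ∧ W = 0 ∧ 0 < E ∧ E = S ∧ E ≤ k then 1
  else if N = 0 ∧ W = 0 ∧ E = S ∧ k < E then 1 + β * x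
  else if 0 < E ∧ E = S ∧ E < N ∧ N = W ∧ N ≤ k then β
  else if k < E ∧ E = S ∧ E < N ∧ N = W then β
  else if 0 < N ∧ N = W ∧ N ≤ k ∧ E = S ∧ k < E then β * (1 + β * x)
  else 0

/-- The set of pipe puzzles for `(u, v, w)` (with separated-descent parameter `k`),
encoded as admissible states of the lattice model. -/
def PP (n k : ℕ) (u v w : Equiv.Perm ℕ) : Set (GridState n) :=
  {sst | BoundaryCond n k u v w sst ∧
    ∀ i j : Fin n, LAdm k (labN sst i j) (labE sst i j) (labW sst i j) (labS sst i j)}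

/-- The set of Schubert pipe puzzles for `(u, v, w)`. -/
def PP0 (n k : ℕ) (u v w : Equiv.Perm ℕ) : Set (GridState n) :=
  {sst | BoundaryCond n k u v w sst ∧
    ∀ i j : Fin n, LAdm0 (labN sst i j) (labE sst i j) (labW sst i j) (labS sst i j)}

/-- The weight `wt(π)` of a pipe puzzle: the product over all tiles, the tile in
row `i` and column `j` having spectral parameter `t_j ⊖ y_i`. -/
def stateWt {K : Type*} [Field K] (β : K) (k : ℕ) (t y : ℕ → K) {n : ℕ}
    (sst : GridState n) : K :=
  ∏ i : Fin n, ∏ j : Fin n,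
    Lwt β k (ominus β (t (j : ℕ)) (y (i : ℕ)))
      (labN sst i j) (labE sst i j) (labW sst i j) (labS sst i j)

/-- The Schubert weight `wt₀(π)`: the product of `t_j - y_i` over the positions
`(i, j)` of the empty tiles. -/
def stateWt0 {K : Type*} [Field K] (t y : ℕ → K) {n : ℕ} (sst : GridState n) : K :=
  ∏ i : Fin n, ∏ j : Fin n,
    if labN sst i j = 0 ∧ labE sst i j = 0 ∧ labW sst i j = 0 ∧ labS sst i j = 0
    then t (j : ℕ) - y (i : ℕ) else 1

/-! ### Tiles as straight or turning moves -/

/-- Weight of a tile in which the label of the east edge leaves through the west edge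
and the label of the north edge leaves through the south edge. -/
def straightWt {K : Type*} [Field K] (x : K) (N E : ℕ) : K :=
  if N = 0 ∧ E = 0 then x else if N = 0 ∨ E < N then 1 else 0

/-- Weight of a tile in which the label of the north edge leaves through the west edge
and the (different) label of the east edge leaves through the south edge. -/
def turnWt {K : Type*} [Field K] (β : K) (k : ℕ) (x : K) (N E : ℕ) : K :=
  if N = E then 0
  else if E = 0 then (if N ≤ k then 1 + β * x else 1)
  else if N = 0 then (if E ≤ k then 1 else 1 + β * x)
  else if N ≤ k ∧ k < E then β * (1 + β * x)
  else if E < N ∧ (N ≤ k ∨ k < E) then β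
  else 0

theorem Lwt_eq_straightWt_add_turnWt {K : Type*} [Field K] (β : K) (k : ℕ) (x : K)
    (N E W S : ℕ) :
    Lwt β k x N E W S = (if W = E ∧ S = N then straightWt x N E else 0) +
      (if W = N ∧ S = E then turnWt β k x N E else 0) := by
  by_cases h1 : W = E ∧ S = N
  · obtain ⟨rfl, rfl⟩ := h1
    rcases lt_trichotomy S W with h | rfl | h
    · rcases Nat.eq_zero_or_pos S with rfl | h0 <;>
        simp (disch := omega) [Lwt, straightWt, if_neg, if_pos]
    · rcases Nat.eq_zero_or_pos S with rfl | h0 <;>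
        simp (disch := omega) [Lwt, straightWt, turnWt, if_neg]
    · rcases Nat.eq_zero_or_pos W with rfl | h0 <;>
        simp (disch := omega) [Lwt, straightWt, if_neg, if_pos]
  · by_cases h2 : W = N ∧ S = E
    · obtain ⟨rfl, rfl⟩ := h2
      have hne : W ≠ S := fun h => h1 ⟨h, h.symm⟩
      clear h1
      rcases Nat.eq_zero_or_pos W with rfl | hW <;> rcases Nat.eq_zero_or_pos S with rfl | hS
      · exact absurd rfl hne
      · rcases Nat.lt_or_ge k S with h | h <;>
          simp (disch := omega) [Lwt, turnWt, if_neg, if_pos]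
      · rcases Nat.lt_or_ge k W with h | h <;>
          simp (disch := omega) [Lwt, turnWt, if_neg, if_pos]
      · rcases Nat.lt_or_gt_of_ne hne with hlt | hlt <;> rcases Nat.lt_or_ge k W with h | h <;>
          rcases Nat.lt_or_ge k S with h' | h' <;> first
            | omega
            | simp (disch := omega) [Lwt, turnWt, if_neg, if_pos]
    · rw [if_neg h1, if_neg h2, add_zero]
      unfold Lwt
      repeat rw [if_neg (by omega)]

theorem Lwt_eq_zero_of_not_LAdm {K : Type*} [Field K] (β : K) (k : ℕ) (x : K)
    {N E W S : ℕ} (h : ¬ LAdm k N E W S) : Lwt β k x N E W S = 0 := by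
  simp only [LAdm, not_or] at h
  obtain ⟨h1, h2, h3, h4, h5, h6, h7, h8, h9, h10, h11⟩ := h
  simp only [Lwt, if_neg h1, if_neg h2, if_neg h3, if_neg h4, if_neg h5, if_neg h6, if_neg h7,
    if_neg h8, if_neg h9, if_neg h10, if_neg h11]

section TileValues

variable {K : Type*} [Field K] (β : K) (k : ℕ) (x : K) {N E : ℕ}

theorem straightWt_zero_zero : straightWt x 0 0 = x := by simp [straightWt]

theorem straightWt_zero_left (h : 0 < E) : straightWt x 0 E = 1 := by
  simp [straightWt, h.ne']

theorem straightWt_of_lt (h : E < N) : straightWt x N E = 1 := by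
  have : ¬ (N = 0 ∧ E = 0) := by omega
  simp [straightWt, this, h]

theorem straightWt_of_le (h0 : 0 < N) (h : N ≤ E) : straightWt x N E = 0 := by
  have h1 : ¬ (N = 0 ∧ E = 0) := by omega
  have h2 : ¬ (N = 0 ∨ E < N) := by omega
  simp only [straightWt, if_neg h1, if_neg h2]

theorem turnWt_self : turnWt β k x N N = 0 := by simp [turnWt]

theorem turnWt_zero_right_of_le (h0 : 0 < N) (h : N ≤ k) :
    turnWt β k x N 0 = 1 + β * x := by simp [turnWt, h0.ne', h]

theorem turnWt_zero_right_of_lt (h : k < N) : turnWt β k x N 0 = 1 := by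
  simp [turnWt, h.not_ge, (Nat.zero_lt_of_lt h).ne']

theorem turnWt_zero_left_of_le (h0 : 0 < E) (h : E ≤ k) : turnWt β k x 0 E = 1 := by
  simp [turnWt, h0.ne, h0.ne', h]

theorem turnWt_zero_left_of_lt (h : k < E) : turnWt β k x 0 E = 1 + β * x := by
  simp [turnWt, h.not_ge, (Nat.zero_lt_of_lt h).ne', (Nat.zero_lt_of_lt h).ne]

theorem turnWt_of_le_of_lt (h0 : 0 < N) (h1 : N ≤ k) (h2 : k < E) :
    turnWt β k x N E = β * (1 + β * x) := by
  simp [turnWt, h0.ne', h1, h2, (h1.trans_lt h2).ne, (Nat.zero_lt_of_lt h2).ne']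

theorem turnWt_of_lt_of_le (h0 : 0 < E) (h : E < N) (h1 : N ≤ k) : turnWt β k x N E = β := by
  have h2 : ¬ k < E := by omega
  simp [turnWt, h0.ne', h.ne', h1, h, (h0.trans h).ne', h2]

theorem turnWt_of_lt_of_lt (h : E < N) (h1 : k < E) : turnWt β k x N E = β := by
  have h2 : ¬ N ≤ k := by omega
  have h3 : E ≠ 0 := by omega
  have h4 : N ≠ 0 := by omega
  simp [turnWt, h.ne', h1, h, h2, h3, h4]

theorem turnWt_of_mixed (h0 : 0 < E) (h1 : E ≤ k) (h2 : k < N) : turnWt β k x N E = 0 := by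
  have h3 : ¬ N ≤ k := by omega
  have h4 : ¬ k < E := by omega
  have h5 : N ≠ 0 := by omega
  simp [turnWt, h0.ne', h3, h4, h5]

theorem turnWt_of_le_of_same (h0 : 0 < N) (h : N < E) (h1 : E ≤ k ∨ k < N) :
    turnWt β k x N E = 0 := by
  have h2 : ¬ (N ≤ k ∧ k < E) := by omega
  have h3 : ¬ E < N := by omega
  have h4 : E ≠ 0 := by omega
  simp only [turnWt, h0.ne', h.ne, h2, h3, h4, if_false, false_and]

end TileValues

/-! ### The exchange relation -/

/-- Diagonal entry of the exchange matrix at the pair of labels `(a, b)`, where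
`b₁ = 1 + β y₁` and `b₂ = 1 + β y₂`. -/
def exchDiag {K : Type*} (k : ℕ) (b₁ b₂ : K) (a b : ℕ) : K :=
  if (0 < a ∧ a ≤ b) ∨ (a = 0 ∧ (b = 0 ∨ k < b)) ∨ (b = 0 ∧ a ≤ k) then b₂ else b₁

/-- Off-diagonal entry of the exchange matrix at the pair of labels `(a, b)`, where
`d = y₁ - y₂`. -/
def exchOff {K : Type*} [Zero K] (d : K) (a b : ℕ) : K :=
  if 0 < b ∧ (a = 0 ∨ b < a) then d else 0

section ExchangeValues

variable {K : Type*} (k : ℕ) (b₁ b₂ : K) {a b : ℕ}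

theorem exchDiag_eq_right
    (h : (0 < a ∧ a ≤ b) ∨ (a = 0 ∧ (b = 0 ∨ k < b)) ∨ (b = 0 ∧ a ≤ k)) :
    exchDiag k b₁ b₂ a b = b₂ := if_pos h

theorem exchDiag_eq_left
    (h : ¬ ((0 < a ∧ a ≤ b) ∨ (a = 0 ∧ (b = 0 ∨ k < b)) ∨ (b = 0 ∧ a ≤ k))) :
    exchDiag k b₁ b₂ a b = b₁ := if_neg h

theorem exchOff_eq [Zero K] (d : K) (h : 0 < b ∧ (a = 0 ∨ b < a)) : exchOff d a b = d := if_pos h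

theorem exchOff_eq_zero [Zero K] (d : K) (h : ¬ (0 < b ∧ (a = 0 ∨ b < a))) :
    exchOff d a b = 0 := if_neg h

end ExchangeValues

/-- `Exchanges β k y₁ y₂ g h` says that applying the exchange matrix to `g` gives `h`. -/
def Exchanges {K : Type*} [Field K] (β : K) (k : ℕ) (y₁ y₂ : K) (g h : ℕ → ℕ → K) : Prop :=
  ∀ a b, (1 + β * y₂) * h a b =
    exchDiag k (1 + β * y₁) (1 + β * y₂) a b * g a b + exchOff (y₁ - y₂) a b * g b a

/-- The effect of appending a column with top label `N` to two adjacent rows with spectral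
parameters `x₁` and `x₂`; the third argument of `g` is the bottom label of the new column. -/
def pairStep {K : Type*} [Field K] (β : K) (k : ℕ) (x₁ x₂ : K) (N : ℕ) (g : ℕ → ℕ → ℕ → K)
    (a b : ℕ) : K :=
  straightWt x₁ N a * straightWt x₂ N b * g a b N +
  straightWt x₁ N a * turnWt β k x₂ N b * g a N b +
  turnWt β k x₁ N a * straightWt x₂ a b * g N b a +
  turnWt β k x₁ N a * turnWt β k x₂ a b * g N a b

set_option maxHeartbeats 4000000 in
/-- The Yang–Baxter equation for a single column. -/
theorem Exchanges.pairStep {K : Type*} [Field K] {β : K} {k : ℕ} {y₁ y₂ : K}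
    (hy₁ : 1 + β * y₁ ≠ 0) (hy₂ : 1 + β * y₂ ≠ 0) (s : K) (N : ℕ) {g h : ℕ → ℕ → ℕ → K}
    (H : ∀ c, Exchanges β k y₁ y₂ (fun a b => g a b c) (fun a b => h a b c)) :
    Exchanges β k y₁ y₂
      (pairStep β k (ominus β s y₁) (ominus β s y₂) N g)
      (pairStep β k (ominus β s y₂) (ominus β s y₁) N h) := by
  have hh : ∀ a b c, h a b c =
      (exchDiag k (1 + β * y₁) (1 + β * y₂) a b * g a b c +
        exchOff (y₁ - y₂) a b * g b a c) / (1 + β * y₂) := fun a b c => by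
    rw [eq_div_iff hy₂, mul_comm]; exact H c a b
  have class_cases : ∀ m : ℕ, m = 0 ∨ (0 < m ∧ m ≤ k) ∨ (0 < m ∧ k < m) := by omega
  intro a b
  simp only [BPDPuzzle.pairStep, hh, ominus]
  rcases class_cases N with hN | hN | hN <;> rcases class_cases a with ha | ha | ha <;>
  rcases class_cases b with hb | hb | hb <;>
  rcases lt_trichotomy N a with hNa | hNa | hNa <;> try omega
  all_goals
    rcases lt_trichotomy N b with hNb | hNb | hNb <;> try omega
  all_goals
    rcases lt_trichotomy a b with hab | hab | hab <;> try omega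
  all_goals
    try subst hNa
    try subst hNb
    try subst hab
    try subst hN
    try subst ha
    try subst hb
    simp (disch := omega) only [straightWt_zero_zero, straightWt_zero_left, straightWt_of_lt,
      straightWt_of_le, turnWt_self, turnWt_zero_right_of_le, turnWt_zero_right_of_lt,
      turnWt_zero_left_of_le, turnWt_zero_left_of_lt, turnWt_of_le_of_lt, turnWt_of_lt_of_le,
      turnWt_of_lt_of_lt, turnWt_of_mixed, turnWt_of_le_of_same, exchDiag_eq_right,
      exchDiag_eq_left, exchOff_eq, exchOff_eq_zero]
    field_simp <;> ring

/-! ### Transfer along rows -/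

/-- The partition function of a single row with `c` columns, column spectral parameters `x`,
top labels `N`, bottom labels `S`, empty left edge and right label `e`. -/
def rowZ {K : Type*} [Field K] (β : K) (k : ℕ) (x : ℕ → K) {n c : ℕ}
    (N S : Fin c → Fin (n + 1)) (e : ℕ) : K :=
  ∑ h : Fin (c + 1) → Fin (n + 1), if (h 0 : ℕ) = 0 ∧ (h (Fin.last c) : ℕ) = e then
    ∏ j : Fin c, Lwt β k (x j) (N j) (h j.succ) (h j.castSucc) (S j) else 0

/-- The partition function of two adjacent rows with `c` columns. -/
def pairZ {K : Type*} [Field K] (β : K) (k : ℕ) (x₁ x₂ : ℕ → K) {n c : ℕ}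
    (N S : Fin c → Fin (n + 1)) (a b : ℕ) : K :=
  ∑ m : Fin c → Fin (n + 1), rowZ β k x₁ N m a * rowZ β k x₂ m S b

section Rows

variable {K : Type*} [Field K] (β : K) (k : ℕ) (x x₁ x₂ : ℕ → K) {n c : ℕ}

theorem rowZ_eq_zero_of_lt (N S : Fin c → Fin (n + 1)) {e : ℕ} (he : n < e) :
    rowZ β k x N S e = 0 := by
  refine Finset.sum_eq_zero fun h _ => if_neg ?_
  have := (h (Fin.last c)).isLt
  omega

theorem rowZ_zero (N S : Fin 0 → Fin (n + 1)) (e : ℕ) :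
    rowZ β k x N S e = if e = 0 then 1 else 0 := by
  rw [rowZ, ← (Equiv.funUnique (Fin 1) (Fin (n + 1))).symm.sum_comp,
    Finset.sum_eq_single (0 : Fin (n + 1))]
  · simp [eq_comm]
  · intro b _ hb
    refine if_neg fun h => hb ?_
    ext
    simpa using h.1
  · simp

theorem rowZ_snoc (N S : Fin c → Fin (n + 1)) (p s e : Fin (n + 1)) :
    rowZ β k x (Fin.snoc N p : Fin (c + 1) → Fin (n + 1)) (Fin.snoc S s) e =
      ∑ w : Fin (n + 1), rowZ β k x N S w * Lwt β k (x c) p e w s := by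
  simp only [rowZ, Finset.sum_mul]
  rw [← (Fin.snocEquiv fun _ => Fin (n + 1)).sum_comp, Fintype.sum_prod_type_right]
  conv_rhs => rw [Finset.sum_comm]
  refine Finset.sum_congr rfl fun h _ => ?_
  have h0 : ∀ z : Fin (n + 1), (Fin.snoc h z : Fin (c + 2) → Fin (n + 1)) 0 = h 0 := fun z => by
    rw [← Fin.castSucc_zero, Fin.snoc_castSucc]
  rw [Finset.sum_eq_single e, Finset.sum_eq_single (h (Fin.last c))]
  · simp [Fin.snocEquiv, h0, Fin.prod_univ_castSucc, Fin.succ_castSucc, -Fin.castSucc_succ]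
  · intro w _ hw
    rw [if_neg fun hh => hw (Fin.ext hh.2.symm), zero_mul]
  · simp
  · intro z _ hz
    refine if_neg fun hh => hz (Fin.ext ?_)
    simpa [Fin.snocEquiv] using hh.2
  · simp

theorem rowZ_snoc_eq (N S : Fin c → Fin (n + 1)) (p s : Fin (n + 1)) (e : ℕ) :
    rowZ β k x (Fin.snoc N p : Fin (c + 1) → Fin (n + 1)) (Fin.snoc S s) e =
      straightWt (x c) p e * (if s = p then rowZ β k x N S e else 0) +
      turnWt β k (x c) p e * (if (s : ℕ) = e then rowZ β k x N S p else 0) := by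
  rcases Nat.lt_or_ge n e with he | he
  · have hs : (s : ℕ) ≠ e := by have := s.isLt; omega
    simp [rowZ_eq_zero_of_lt β k x _ _ he, hs]
  · obtain ⟨e, rfl⟩ : ∃ e' : Fin (n + 1), (e' : ℕ) = e := ⟨⟨e, by omega⟩, rfl⟩
    rw [rowZ_snoc]
    simp only [Lwt_eq_straightWt_add_turnWt, mul_add, Finset.sum_add_distrib, ite_and,
      Fin.val_inj, mul_ite, mul_zero, Finset.sum_ite_eq', Finset.mem_univ, if_true, mul_comm]

theorem pairZ_snoc (N S : Fin c → Fin (n + 1)) (p s : Fin (n + 1)) (a b : ℕ) :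
    pairZ β k x₁ x₂ (Fin.snoc N p : Fin (c + 1) → Fin (n + 1)) (Fin.snoc S s) a b =
      pairStep β k (x₁ c) (x₂ c) p
        (fun a' b' s' => if (s : ℕ) = s' then pairZ β k x₁ x₂ N S a' b' else 0) a b := by
  rcases Nat.lt_or_ge n a with ha | ha
  · have hs : (s : ℕ) ≠ a := by have := s.isLt; omega
    simp [pairZ, pairStep, rowZ_eq_zero_of_lt β k _ _ _ ha, hs]
  · obtain ⟨a, rfl⟩ : ∃ a' : Fin (n + 1), (a' : ℕ) = a := ⟨⟨a, by omega⟩, rfl⟩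
    have hsum : ∀ (A B : K) (F : Fin (n + 1) → K),
        ∑ m : Fin (n + 1), ((if m = p then A else 0) + (if m = a then B else 0)) * F m =
          A * F p + B * F a := fun A B F => by
      simp [add_mul, Finset.sum_add_distrib]
    have hite : ∀ (P : Prop) [Decidable P] (f : (Fin c → Fin (n + 1)) → K),
        (if P then ∑ m, f m else 0) = ∑ m, if P then f m else 0 := fun P _ f => by
      split_ifs <;> simp
    rw [pairZ, ← (Fin.snocEquiv fun _ => Fin (n + 1)).sum_comp, Fintype.sum_prod_type_right]
    simp only [Fin.snocEquiv, Equiv.coe_fn_mk, pairStep, rowZ_snoc_eq, mul_ite, mul_zero,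
      Fin.val_inj, hsum, pairZ, Finset.mul_sum, hite, ← Finset.sum_add_distrib]
    refine Finset.sum_congr rfl fun m _ => ?_
    split_ifs <;> ring

theorem exchanges_pairZ {y₁ y₂ : K} (hy₁ : 1 + β * y₁ ≠ 0) (hy₂ : 1 + β * y₂ ≠ 0) (t : ℕ → K) :
    ∀ {c : ℕ} (N S : Fin c → Fin (n + 1)), Exchanges β k y₁ y₂
      (pairZ β k (fun j => ominus β (t j) y₁) (fun j => ominus β (t j) y₂) N S)
      (pairZ β k (fun j => ominus β (t j) y₂) (fun j => ominus β (t j) y₁) N S) := by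
  intro c
  induction c with
  | zero =>
    intro N S a b
    simp only [pairZ, rowZ_zero, exchDiag, exchOff, Finset.univ_unique, Finset.sum_singleton]
    rcases Nat.eq_zero_or_pos a with rfl | ha <;> rcases Nat.eq_zero_or_pos b with rfl | hb
    · simp
    · simp [hb.ne']
    · simp [ha.ne']
    · simp [ha.ne']
  | succ c ih =>
    intro N S
    rw [← Fin.snoc_init_self N, ← Fin.snoc_init_self S]
    have key := Exchanges.pairStep hy₁ hy₂ (t c) (N (Fin.last c))
      (g := fun a b s => if (S (Fin.last c) : ℕ) = s then
        pairZ β k (fun j => ominus β (t j) y₁) (fun j => ominus β (t j) y₂)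
          (Fin.init N) (Fin.init S) a b else 0)
      (h := fun a b s => if (S (Fin.last c) : ℕ) = s then
        pairZ β k (fun j => ominus β (t j) y₂) (fun j => ominus β (t j) y₁)
          (Fin.init N) (Fin.init S) a b else 0)
      (k := k) fun s => by
        intro a b
        by_cases hs : (S (Fin.last c) : ℕ) = s
        · simpa only [if_pos hs] using ih (Fin.init N) (Fin.init S) a b
        · simp only [if_neg hs, mul_zero, add_zero]
    intro a b
    rw [pairZ_snoc, pairZ_snoc, pairZ_snoc]
    exact key a b

end Rows

/-! ### The partition function as a product of row transfers -/

/-- Top and bottom boundary conditions on the vertical edges. -/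
def VertCond {n : ℕ} (k : ℕ) (v w : Equiv.Perm ℕ) (V : Fin (n + 1) → Fin n → Fin (n + 1)) : Prop :=
  (∀ j : Fin n, (V 0 j : ℕ) = thetaLab k v j) ∧
  (∀ j : Fin n, (V (Fin.last n) j : ℕ) = etaLab w j)

open scoped Classical in
theorem finsum_PP_eq_sum_prod_rowZ {K : Type*} [Field K] (β : K) (n k : ℕ)
    (u v w : Equiv.Perm ℕ) (t y : ℕ → K) :
    (∑ᶠ π ∈ PP n k u v w, stateWt β k t y π) =
      ∑ V : Fin (n + 1) → Fin n → Fin (n + 1), if VertCond k v w V then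
        ∏ i : Fin n, rowZ β k (fun j => ominus β (t j) (y i)) (V i.castSucc) (V i.succ)
          (kappaLab k u i) else 0 := by
  have hind : ∀ π : GridState n, (PP n k u v w).indicator (stateWt β k t y) π =
      if BoundaryCond n k u v w π then stateWt β k t y π else 0 := fun π => by
    by_cases hB : BoundaryCond n k u v w π
    · rw [if_pos hB, Set.indicator_apply]
      split_ifs with hP
      · rfl
      · obtain ⟨i, j, hij⟩ : ∃ i j : Fin n,
            ¬ LAdm k (labN π i j) (labE π i j) (labW π i j) (labS π i j) := by
          by_contra! hcon
          exact hP ⟨hB, hcon⟩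
        exact (Finset.prod_eq_zero (Finset.mem_univ i) (Finset.prod_eq_zero (Finset.mem_univ j)
          (Lwt_eq_zero_of_not_LAdm β k _ hij))).symm
    · rw [if_neg hB, Set.indicator_of_notMem fun hP => hB hP.1]
  rw [finsum_mem_def, finsum_eq_sum_of_fintype, Finset.sum_congr rfl fun π _ => hind π,
    Fintype.sum_prod_type_right]
  refine Finset.sum_congr rfl fun V _ => ?_
  by_cases hV : VertCond k v w V
  · rw [if_pos hV]
    simp only [rowZ]
    rw [Fintype.prod_sum]
    refine Finset.sum_congr rfl fun H _ => ?_
    rw [Finset.prod_ite_zero]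
    by_cases hB : BoundaryCond n k u v w (H, V)
    · rw [if_pos hB, if_pos fun i _ => ⟨hB.1 i, hB.2.1 i⟩]
      rfl
    · rw [if_neg hB, if_neg fun h => hB ⟨fun i => (h i (Finset.mem_univ i)).1,
        fun i => (h i (Finset.mem_univ i)).2, hV⟩]
  · rw [if_neg hV]
    exact Finset.sum_eq_zero fun H _ => if_neg fun h => hV h.2.2

theorem sum_eq_zero_of_sum_update_eq_zero {n : ℕ} {α K : Type*} [Fintype α] [AddCommMonoid K]
    (p : Fin (n + 1)) (D : (Fin (n + 1) → α) → K)
    (h : ∀ V, ∑ m, D (Function.update V p m) = 0) : ∑ V, D V = 0 := by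
  rw [← (Fin.insertNthEquiv (fun _ => α) p).sum_comp, Fintype.sum_prod_type_right]
  refine Finset.sum_eq_zero fun V _ => ?_
  rcases isEmpty_or_nonempty α with hα | ⟨⟨a⟩⟩
  · simp
  · simpa [Fin.insertNthEquiv] using h (p.insertNth a V)

/-- Separate the factors at two adjacent rows from a product of transfers. -/
theorem prod_transfer_update {n : ℕ} {α K : Type*} [CommMonoid K] (f : Fin n → α → α → K)
    (V : Fin (n + 1) → α) (m : α) {r r' : Fin n} (hr : (r' : ℕ) = r + 1) :
    ∏ i : Fin n, f i (Function.update V r.succ m i.castSucc) (Function.update V r.succ m i.succ) =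
      (∏ i ∈ (Finset.univ.erase r).erase r', f i (V i.castSucc) (V i.succ)) *
        (f r (V r.castSucc) m * f r' m (V r'.succ)) := by
  have hne : r' ≠ r := fun h => by simp [h] at hr
  have hcast : r'.castSucc = r.succ := Fin.ext (by simpa using hr)
  rw [← Finset.mul_prod_erase _ _ (Finset.mem_univ r),
    ← Finset.mul_prod_erase _ _ (Finset.mem_erase.2 ⟨hne, Finset.mem_univ r'⟩), hcast,
    Function.update_self,
    Function.update_of_ne (by simp [Fin.ext_iff]), Function.update_of_ne (by simp [hne]),
    ← mul_assoc, mul_comm]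
  congr 1
  refine Finset.prod_congr rfl fun i hi => ?_
  simp only [Finset.mem_erase, Finset.mem_univ, and_true, ne_eq, Fin.ext_iff] at hi
  rw [Function.update_of_ne, Function.update_of_ne]
  · simpa [Fin.ext_iff] using hi.2
  · simp only [ne_eq, Fin.ext_iff, Fin.val_castSucc, Fin.val_succ]
    omega

/-! ### Descents and boundary labels -/

theorem inversions_finite {n : ℕ} {w : Equiv.Perm ℕ} (hw : InSn n w) :
    {p : ℕ × ℕ | p.1 < p.2 ∧ w p.2 < w p.1}.Finite := by
  refine ((Set.finite_Iio n).prod (Set.finite_Iio n)).subset ?_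
  rintro ⟨a, b⟩ ⟨hab, hinv⟩
  simp only at hab hinv
  have hb : b < n := by
    by_contra! hb
    rw [hw b hb] at hinv
    have := w.injective (hw (w a) (by omega))
    omega
  exact ⟨hab.trans hb, hb⟩

theorem inv_lt_inv_of_len_lt {n i : ℕ} (hi : i + 1 < n) {u : Equiv.Perm ℕ} (hu : InSn n u)
    (hlen : len (sTr i * u) < len u) : u⁻¹ (i + 1) < u⁻¹ i := by
  by_contra! hcon
  refine hlen.not_ge (Set.ncard_le_ncard ?_ (inversions_finite (n := n) fun j hj => ?_))
  · rintro ⟨a, b⟩ ⟨hab, hinv⟩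
    refine ⟨hab, ?_⟩
    simp only [sTr, Equiv.Perm.mul_apply, Equiv.swap_apply_def] at hab hinv ⊢
    have hne : ¬ (u b = i ∧ u a = i + 1) := fun h => by
      rw [← h.2, ← h.1] at hcon
      simp only [Equiv.Perm.inv_def, Equiv.symm_apply_apply] at hcon
      omega
    split_ifs <;> omega
  · rw [Equiv.Perm.mul_apply, hu j hj, sTr, Equiv.swap_apply_of_ne_of_ne] <;> omega

theorem le_apply_of_ascending {k : ℕ} {u : Equiv.Perm ℕ} (h : ∀ i, k ≤ i → u i ≤ u (i + 1))
    {a b : ℕ} (ha : k ≤ a) (hab : a ≤ b) : u a ≤ u b := by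
  induction b, hab using Nat.le_induction with
  | base => rfl
  | succ b hab ih => exact ih.trans (h b (ha.trans hab))

theorem kappaLab_sTr_mul (k : ℕ) (u : Equiv.Perm ℕ) (i j : ℕ) :
    kappaLab k (sTr i * u) j = kappaLab k u (Equiv.swap i (i + 1) j) := by
  simp [kappaLab, sTr, mul_inv_rev, Equiv.Perm.mul_apply]

/-- Theorem `thm:indonu` of the paper.  Let `u, v ∈ S_n` have
separated descents at position `k`, let `w ∈ S_n`, and suppose
`ℓ(s_i u) < ℓ(u)`.  Writing `Z_{u,v}^w(t,y) = Σ_{π ∈ PP(u,v,w)} wt(π)`, one has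
`Z_{s_i u, v}^w = -((1+βy_i)/(y_i-y_{i+1}))·Z_{u,v}^w
  + ((1+βy_{i+1})/(y_i-y_{i+1}))·Z_{u,v}^w|_{y_i ↔ y_{i+1}}`. -/
theorem partition_function_recurrence_in_u
    {K : Type*} [Field K] (β : K)
    (n k : ℕ) (hk : k ≤ n)
    (u v w : Equiv.Perm ℕ) (hu : InSn n u) (hv : InSn n v) (hw : InSn n w)
    (hsep : SepDesc k u v)
    (i : ℕ) (hi : i + 1 < n)
    (hlen : len (sTr i * u) < len u)
    (t y : ℕ → K)
    (ht : ∀ j, 1 + β * t j ≠ 0) (hy : ∀ j, 1 + β * y j ≠ 0)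
    (hyy : y i ≠ y (i + 1)) :
    (∑ᶠ π ∈ PP n k (sTr i * u) v w, stateWt β k t y π) =
      -((1 + β * y i) / (y i - y (i + 1))) *
          (∑ᶠ π ∈ PP n k u v w, stateWt β k t y π)
        + ((1 + β * y (i + 1)) / (y i - y (i + 1))) *
            ∑ᶠ π ∈ PP n k u v w, stateWt β k t (swapVal y i) π := by
  classical
  have hdesc := inv_lt_inv_of_len_lt hi hu hlen
  have hk' : u⁻¹ (i + 1) < k := by
    by_contra! hcon
    have := le_apply_of_ascending hsep.1 hcon hdesc.le
    simp [Equiv.Perm.inv_def] at this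
  have ha : kappaLab k u (i + 1) = u⁻¹ (i + 1) + 1 := if_pos hk'
  have hab : kappaLab k u i = 0 ∨ kappaLab k u (i + 1) < kappaLab k u i := by
    rw [ha, kappaLab]
    split_ifs <;> omega
  have hd : y i - y (i + 1) ≠ 0 := sub_ne_zero.2 hyy
  have hdiag : exchDiag k (1 + β * y i) (1 + β * y (i + 1)) (kappaLab k u i)
      (kappaLab k u (i + 1)) = 1 + β * y i := exchDiag_eq_left _ _ _ (by omega)
  have hoff : exchOff (y i - y (i + 1)) (kappaLab k u i) (kappaLab k u (i + 1)) =
      y i - y (i + 1) := exchOff_eq _ (by omega)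
  obtain ⟨r, hr⟩ : ∃ r : Fin n, (r : ℕ) = i := ⟨⟨i, by omega⟩, rfl⟩
  obtain ⟨r', hr'⟩ : ∃ r' : Fin n, (r' : ℕ) = i + 1 := ⟨⟨i + 1, hi⟩, rfl⟩
  rw [finsum_PP_eq_sum_prod_rowZ, finsum_PP_eq_sum_prod_rowZ, finsum_PP_eq_sum_prod_rowZ]
  have key : ∀ {A B C : K}, (y i - y (i + 1)) * A + (1 + β * y i) * B -
      (1 + β * y (i + 1)) * C = 0 → A = -((1 + β * y i) / (y i - y (i + 1))) * B +
        ((1 + β * y (i + 1)) / (y i - y (i + 1))) * C := fun {A B C} h => by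
    field_simp
    linear_combination h
  apply key
  rw [Finset.mul_sum, Finset.mul_sum, Finset.mul_sum, ← Finset.sum_add_distrib,
    ← Finset.sum_sub_distrib]
  refine sum_eq_zero_of_sum_update_eq_zero r.succ _ fun V => ?_
  have hV : ∀ m, VertCond k v w (Function.update V r.succ m) ↔ VertCond k v w V := fun m => by
    have h0 : (0 : Fin (n + 1)) ≠ r.succ := (Fin.succ_ne_zero r).symm
    have h1 : Fin.last n ≠ r.succ := fun h => by
      have := congrArg Fin.val h
      simp only [Fin.val_last, Fin.val_succ] at this
      omega
    simp only [VertCond, Function.update_of_ne h0, Function.update_of_ne h1]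
  by_cases hVert : VertCond k v w V
  swap
  · exact Finset.sum_eq_zero fun m _ => by
      simp only [hV, hVert, if_false, mul_zero, add_zero, sub_zero]
  have hrr : (r' : ℕ) = r + 1 := by omega
  simp only [hV, hVert, if_true]
  simp only [prod_transfer_update (fun (j : Fin n) N S =>
      rowZ β k (fun c => ominus β (t c) (y j)) N S (kappaLab k (sTr i * u) j)) V _ hrr,
    prod_transfer_update (fun (j : Fin n) N S =>
      rowZ β k (fun c => ominus β (t c) (y j)) N S (kappaLab k u j)) V _ hrr,
    prod_transfer_update (fun (j : Fin n) N S =>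
      rowZ β k (fun c => ominus β (t c) (swapVal y i j)) N S (kappaLab k u j)) V _ hrr]
  have hrest : ∀ j ∈ (Finset.univ.erase r).erase r', (j : ℕ) ≠ i ∧ (j : ℕ) ≠ i + 1 := by
    intro j hj
    simp only [Finset.mem_erase, Finset.mem_univ, and_true, ne_eq, Fin.ext_iff] at hj
    omega
  have hprod : ∀ (y' : ℕ → K) (κ : ℕ → ℕ),
      (∀ j, j ≠ i → j ≠ i + 1 → y' j = y j ∧ κ j = kappaLab k u j) →
      ∏ j ∈ (Finset.univ.erase r).erase r', rowZ β k (fun c => ominus β (t c) (y' j))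
        (V j.castSucc) (V j.succ) (κ j) =
      ∏ j ∈ (Finset.univ.erase r).erase r', rowZ β k (fun c => ominus β (t c) (y j))
        (V j.castSucc) (V j.succ) (kappaLab k u j) := fun y' κ h =>
    Finset.prod_congr rfl fun j hj => by
      rw [(h j (hrest j hj).1 (hrest j hj).2).1, (h j (hrest j hj).1 (hrest j hj).2).2]
  rw [hprod y (kappaLab k (sTr i * u)) fun j h h' => ⟨rfl, by
      rw [kappaLab_sTr_mul, Equiv.swap_apply_of_ne_of_ne h h']⟩,
    hprod (swapVal y i) (kappaLab k u) fun j h h' => ⟨by rw [swapVal, if_neg h, if_neg h'], rfl⟩]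
  have hex := exchanges_pairZ (n := n) β k (hy i) (hy (i + 1)) t (V r.castSucc) (V r'.succ)
    (kappaLab k u i) (kappaLab k u (i + 1))
  rw [hdiag, hoff] at hex
  simp only [hr, hr', kappaLab_sTr_mul, Equiv.swap_apply_left, Equiv.swap_apply_right, swapVal,
    if_true, Nat.succ_ne_self, if_false]
  rw [Finset.sum_sub_distrib, Finset.sum_add_distrib]
  simp only [← Finset.mul_sum]
  simp only [pairZ] at hex
  linear_combination (-(∏ j ∈ (Finset.univ.erase r).erase r', rowZ β k
    (fun c => ominus β (t c) (y j)) (V j.castSucc) (V j.succ) (kappaLab k u j))) * hex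
end BPDPuzzle
end
end

section
/- Let u,v ∈ S_n have separated descents. Then 𝔖_u(x)·𝔖_v(x,t) lies in Σ_w ℤ_{≥0}[t]·𝔖_w(x,t); that is, each coefficient c̄_{u,v}^w(t,0) in the expansion 𝔖_u(x)·𝔖_v(x,t)=Σ_w c̄_{u,v}^w(t,0)·𝔖_w(x,t) is a polynomial in the t-variables with nonnegative integer coefficients. -/
open MvPolynomial

noncomputable section

namespace BPDPuzzle

/-! ### Divided differences -/

section DividedDifference

variable {R : Type*} [CommRing R]

theorem X_sub_X_dvd_sub_rename_swap (i : ℕ) (f : MvPolynomial ℕ R) :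
    X i - X (i + 1) ∣ f - rename ⇑(Equiv.swap i (i + 1)) f := by
  induction f using MvPolynomial.induction_on with
  | C a => simp
  | add p q hp hq =>
    rw [map_add, add_sub_add_comm]
    exact dvd_add hp hq
  | mul_X p j hp =>
    have hX : (X i - X (i + 1) : MvPolynomial ℕ R) ∣ X j - X (Equiv.swap i (i + 1) j) := by
      rcases eq_or_ne j i with rfl | h1
      · simp
      rcases eq_or_ne j (i + 1) with rfl | h2
      · exact ⟨-1, by rw [Equiv.swap_apply_right]; ring⟩
      · simp [Equiv.swap_apply_of_ne_of_ne h1 h2]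
    rw [map_mul, rename_X]
    have : p * X j - rename (⇑(Equiv.swap i (i + 1))) p * X (Equiv.swap i (i + 1) j)
        = (p - rename (⇑(Equiv.swap i (i + 1))) p) * X j
          + rename (⇑(Equiv.swap i (i + 1))) p * (X j - X (Equiv.swap i (i + 1) j)) := by ring
    rw [this]
    exact dvd_add (hp.mul_right _) (hX.mul_left _)

theorem X_sub_X_succ_ne_zero [Nontrivial R] (i : ℕ) :
    (X i - X (i + 1) : MvPolynomial ℕ R) ≠ 0 :=
  sub_ne_zero.2 fun h => absurd (X_injective h) i.succ_ne_self.symm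

/-- The polynomial underlying the divided difference `∂_i f = (f - s_i f)/(x_i - x_{i+1})`. -/
def ddiffFun (i : ℕ) (f : MvPolynomial ℕ R) : MvPolynomial ℕ R :=
  (X_sub_X_dvd_sub_rename_swap i f).choose

theorem ddiffFun_spec (i : ℕ) (f : MvPolynomial ℕ R) :
    (X i - X (i + 1)) * ddiffFun i f = f - rename ⇑(Equiv.swap i (i + 1)) f :=
  (X_sub_X_dvd_sub_rename_swap i f).choose_spec.symm

variable [IsDomain R]

/-- The divided difference operator `∂_i`. -/
def ddiff (i : ℕ) : MvPolynomial ℕ R →ₗ[R] MvPolynomial ℕ R where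
  toFun := ddiffFun i
  map_add' f g := mul_left_cancel₀ (X_sub_X_succ_ne_zero i) <| by
    rw [mul_add, ddiffFun_spec, ddiffFun_spec, ddiffFun_spec, map_add]; ring
  map_smul' a f := mul_left_cancel₀ (X_sub_X_succ_ne_zero i) <| by
    rw [RingHom.id_apply, mul_smul_comm, ddiffFun_spec, ddiffFun_spec, map_smul, smul_sub]

theorem ddiff_spec (i : ℕ) (f : MvPolynomial ℕ R) :
    (X i - X (i + 1)) * ddiff i f = f - rename ⇑(Equiv.swap i (i + 1)) f :=
  ddiffFun_spec i f

theorem ddiff_eq {i : ℕ} {f g : MvPolynomial ℕ R}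
    (h : (X i - X (i + 1)) * g = f - rename ⇑(Equiv.swap i (i + 1)) f) : ddiff i f = g :=
  mul_left_cancel₀ (X_sub_X_succ_ne_zero i) ((ddiff_spec i f).trans h.symm)

theorem rename_ddiff (i : ℕ) (f : MvPolynomial ℕ R) :
    rename ⇑(Equiv.swap i (i + 1)) (ddiff i f) = ddiff i f := by
  refine mul_left_cancel₀ (X_sub_X_succ_ne_zero i) ?_
  have h := congrArg (rename ⇑(Equiv.swap i (i + 1))) (ddiff_spec i f)
  simp only [map_mul, map_sub, rename_X, Equiv.swap_apply_left, Equiv.swap_apply_right,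
    rename_rename, ← Equiv.coe_trans, Equiv.swap_swap, Equiv.coe_refl, rename_id_apply] at h
  rw [ddiff_spec]
  linear_combination -h

theorem ddiff_ddiff (i : ℕ) (f : MvPolynomial ℕ R) : ddiff i (ddiff i f) = 0 :=
  ddiff_eq (by rw [rename_ddiff]; ring)

theorem ddiff_mul_of_rename_eq {i : ℕ} {f : MvPolynomial ℕ R}
    (hf : rename ⇑(Equiv.swap i (i + 1)) f = f) (g : MvPolynomial ℕ R) :
    ddiff i (f * g) = f * ddiff i g :=
  ddiff_eq (by rw [mul_left_comm, ddiff_spec, map_mul, hf]; ring)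

theorem rename_eq_of_ddiff_eq_zero {i : ℕ} {f : MvPolynomial ℕ R} (hf : ddiff i f = 0) :
    rename ⇑(Equiv.swap i (i + 1)) f = f := by
  have h := ddiff_spec i f
  rw [hf, mul_zero] at h
  exact (sub_eq_zero.1 h.symm).symm

theorem ddiff_X_mul (i : ℕ) (g : MvPolynomial ℕ R) :
    ddiff i (X i * g) = g + X (i + 1) * ddiff i g :=
  ddiff_eq (by
    rw [map_mul, rename_X, Equiv.swap_apply_left]
    linear_combination X (i + 1) * ddiff_spec i g)

theorem map_ddiff {R' : Type*} [CommRing R'] [IsDomain R'] (φ : R →+* R') (i : ℕ)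
    (f : MvPolynomial ℕ R) : MvPolynomial.map φ (ddiff i f) = ddiff i (MvPolynomial.map φ f) := by
  symm
  apply ddiff_eq
  have h := congrArg (MvPolynomial.map φ) (ddiff_spec i f)
  simpa [map_rename] using h

theorem eval_ddiff (i : ℕ) (a : ℕ → R) (f : MvPolynomial ℕ R) :
    (a i - a (i + 1)) * eval a (ddiff i f)
      = eval a f - eval (a ∘ ⇑(Equiv.swap i (i + 1))) f := by
  have h := congrArg (eval a) (ddiff_spec i f)
  simpa [eval_rename] using h

/-- The composition of divided differences along a list, the head being applied first. -/
def ddiffList : List ℕ → MvPolynomial ℕ R →ₗ[R] MvPolynomial ℕ R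
  | [] => LinearMap.id
  | i :: l => ddiffList l ∘ₗ ddiff i

theorem ddiffList_cons (i : ℕ) (l : List ℕ) (f : MvPolynomial ℕ R) :
    ddiffList (i :: l) f = ddiffList l (ddiff i f) := rfl

end DividedDifference

/-! ### Permutations, codes and descents -/

theorem mul_sTr_apply_left (w : Equiv.Perm ℕ) (i : ℕ) : (w * sTr i) i = w (i + 1) := by
  simp [sTr]

theorem mul_sTr_apply_right (w : Equiv.Perm ℕ) (i : ℕ) : (w * sTr i) (i + 1) = w i := by
  simp [sTr]

theorem mul_sTr_apply_of_ne (w : Equiv.Perm ℕ) {i j : ℕ} (h : j ≠ i) (h' : j ≠ i + 1) :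
    (w * sTr i) j = w j := by
  simp [sTr, Equiv.swap_apply_of_ne_of_ne h h']

theorem mul_sTr_mul_sTr (w : Equiv.Perm ℕ) (i : ℕ) : w * sTr i * sTr i = w := by
  simp [sTr, mul_assoc]

theorem InSn.mul_sTr {n : ℕ} {w : Equiv.Perm ℕ} (hw : InSn n w) {i : ℕ} (hi : i + 1 < n) :
    InSn n (w * sTr i) := fun j hj => by
  rw [mul_sTr_apply_of_ne w (by omega) (by omega), hw j hj]

theorem InSn.mono {m n : ℕ} (h : m ≤ n) {w : Equiv.Perm ℕ} (hw : InSn m w) : InSn n w :=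
  fun j hj => hw j (h.trans hj)

theorem InSn.apply_lt {n : ℕ} {w : Equiv.Perm ℕ} (hw : InSn n w) {j : ℕ} (hj : j < n) :
    w j < n := by
  by_contra! h
  have := w.injective (hw _ h)
  omega

theorem InSn.lt_of_descent {n : ℕ} {w : Equiv.Perm ℕ} (hw : InSn n w) {i : ℕ}
    (hi : w (i + 1) < w i) : i + 1 < n := by
  by_contra! h
  rw [hw (i + 1) h] at hi
  rcases h.lt_or_eq with h | h
  · rw [hw i (by omega)] at hi; omega
  · have := hw.apply_lt (j := i) (by omega); omega

theorem InSn.one (n : ℕ) : InSn n 1 := fun _ _ => rfl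

/-- The `p`-th entry of the Lehmer code of `w ∈ S_n`. -/
def code (n : ℕ) (w : Equiv.Perm ℕ) (p : ℕ) : ℕ :=
  ((Finset.range n).filter fun q => p < q ∧ w q < w p).card

/-- The number of inversions of `w ∈ S_n`. -/
def inv (n : ℕ) (w : Equiv.Perm ℕ) : ℕ := ∑ p ∈ Finset.range n, code n w p

section Code

variable {n i : ℕ} {w : Equiv.Perm ℕ}

theorem code_mul_sTr_left (hi : w (i + 1) < w i) :
    code n (w * sTr i) i = code n w (i + 1) := by
  unfold code
  congr 1
  ext q
  simp only [Finset.mem_filter, Finset.mem_range, mul_sTr_apply_left]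
  rcases lt_trichotomy q (i + 1) with h | rfl | h
  · constructor <;> rintro ⟨_, _, _⟩ <;> omega
  · rw [mul_sTr_apply_right]; omega
  · rw [mul_sTr_apply_of_ne w (by omega) (by omega)]; omega

theorem code_mul_sTr_right (hn : i + 1 < n) (hi : w (i + 1) < w i) :
    code n (w * sTr i) (i + 1) + 1 = code n w i := by
  unfold code
  rw [← Finset.card_insert_of_notMem (a := i + 1) (by
    rw [Finset.mem_filter]; omega)]
  congr 1
  ext q
  simp only [Finset.mem_insert, Finset.mem_filter, Finset.mem_range, mul_sTr_apply_right]
  rcases lt_trichotomy q (i + 1) with h | rfl | h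
  · constructor
    · rintro (h | ⟨_, _, _⟩) <;> omega
    · rintro ⟨_, _, _⟩; omega
  · omega
  · rw [mul_sTr_apply_of_ne w (by omega) (by omega)]; omega

theorem code_mul_sTr_of_ne (hn : i + 1 < n) {p : ℕ} (h : p ≠ i) (h' : p ≠ i + 1) :
    code n (w * sTr i) p = code n w p := by
  have key : ∀ q, (q < n ∧ p < q) → (sTr i q < n ∧ p < sTr i q) := by
    intro q hq
    rcases eq_or_ne q i with rfl | h1
    · simp only [sTr, Equiv.swap_apply_left]; omega
    rcases eq_or_ne q (i + 1) with rfl | h2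
    · simp only [sTr, Equiv.swap_apply_right]; omega
    · simpa only [sTr, Equiv.swap_apply_of_ne_of_ne h1 h2] using hq
  have invol : ∀ q, sTr i (sTr i q) = q := fun q => by simp [sTr]
  refine Finset.card_nbij' (sTr i) (sTr i) ?_ ?_ (fun q _ => invol q) (fun q _ => invol q)
  · intro q hq
    simp only [Finset.coe_filter, Finset.mem_range, Set.mem_ofPred_eq] at hq ⊢
    rw [mul_sTr_apply_of_ne w h h'] at hq
    exact ⟨(key q ⟨hq.1, hq.2.1⟩).1, (key q ⟨hq.1, hq.2.1⟩).2, hq.2.2⟩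
  · intro q hq
    simp only [Finset.coe_filter, Finset.mem_range, Set.mem_ofPred_eq] at hq ⊢
    rw [mul_sTr_apply_of_ne w h h', Equiv.Perm.mul_apply, invol]
    exact ⟨(key q ⟨hq.1, hq.2.1⟩).1, (key q ⟨hq.1, hq.2.1⟩).2, hq.2.2⟩

theorem inv_mul_sTr (hn : i + 1 < n) (hi : w (i + 1) < w i) :
    inv n (w * sTr i) + 1 = inv n w := by
  have split : ∀ f : ℕ → ℕ, ∑ p ∈ Finset.range n, f p
      = f i + (f (i + 1) + ∑ p ∈ ((Finset.range n).erase i).erase (i + 1), f p) := fun f => by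
    rw [Finset.add_sum_erase _ f (by simp; omega), Finset.add_sum_erase _ f (by simp; omega)]
  unfold inv
  rw [split, split (code n w), code_mul_sTr_left hi, ← code_mul_sTr_right hn hi,
    Finset.sum_congr rfl fun p hp => code_mul_sTr_of_ne (w := w) hn (p := p) ?_ ?_]
  · ring
  all_goals simp only [Finset.mem_erase] at hp; tauto

theorem inv_mul_sTr_le (hn : i + 1 < n) : inv n (w * sTr i) ≤ inv n w + 1 := by
  rcases lt_trichotomy (w (i + 1)) (w i) with h | h | h
  · have := inv_mul_sTr hn h; omega
  · exact absurd (w.injective h) (by simp)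
  · have := inv_mul_sTr (w := w * sTr i) hn (by
      rwa [mul_sTr_apply_left, mul_sTr_apply_right])
    rw [mul_sTr_mul_sTr] at this
    omega

theorem inv_one : inv n 1 = 0 := by
  refine Finset.sum_eq_zero fun p _ => Finset.card_eq_zero.2 (Finset.filter_eq_empty_iff.2 ?_)
  rintro q - ⟨h1, h2⟩
  exact absurd h1 h2.not_gt

theorem inv_le : inv n w ≤ n * n := by
  refine (Finset.sum_le_card_nsmul _ _ n fun p _ => ?_).trans (by simp)
  exact (Finset.card_filter_le _ _).trans (by simp)

end Code

theorem revPerm_inSn (n : ℕ) : InSn n (revPerm n) := fun j hj => by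
  simp [revPerm, hj.not_gt]

theorem revPerm_apply {n j : ℕ} (hj : j < n) : revPerm n j = n - 1 - j := by
  simp [revPerm, hj]

theorem eq_revPerm_of_le {n : ℕ} {w : Equiv.Perm ℕ} (hw : InSn n w)
    (h : ∀ j < n, n - 1 - j ≤ w j) : w = revPerm n := by
  have key : ∀ j < n, w j = n - 1 - j := by
    intro j
    induction j using Nat.strong_induction_on with
    | _ j ih =>
      intro hj
      have h1 := h j hj
      have h2 := hw.apply_lt hj
      by_contra hne
      have h3 := ih (n - 1 - w j) (by omega) (by omega)
      have := w.injective (h3.trans (by omega : n - 1 - (n - 1 - w j) = w j))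
      omega
  ext j
  rcases lt_or_ge j n with hj | hj
  · rw [key j hj, revPerm_apply hj]
  · rw [hw j hj, revPerm_inSn n j hj]

theorem exists_ascent_of_ne_revPerm {n : ℕ} {w : Equiv.Perm ℕ} (hw : InSn n w)
    (hne : w ≠ revPerm n) : ∃ i, i + 1 < n ∧ w i < w (i + 1) := by
  by_contra! h
  refine hne (eq_revPerm_of_le hw fun j hj => ?_)
  have : ∀ d j, j < n → n - 1 - j = d → d ≤ w j := by
    intro d
    induction d with
    | zero => intros; omega
    | succ d ih =>
      intro j hj hd
      have h1 := ih (j + 1) (by omega) (by omega)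
      have h2 := h j (by omega)
      have h3 : w (j + 1) ≠ w j := fun e => absurd (w.injective e) (by simp)
      omega
  exact this _ j hj rfl

/-- Every element of `S_n` is reached from the longest one by removing descents. -/
theorem InSn.induction {n : ℕ} {motive : Equiv.Perm ℕ → Prop} (top : motive (revPerm n))
    (step : ∀ w i, InSn n w → i + 1 < n → w (i + 1) < w i → motive w → motive (w * sTr i))
    {w : Equiv.Perm ℕ} (hw : InSn n w) : motive w := by
  induction hm : n * n - inv n w using Nat.strong_induction_on generalizing w with
  | _ m ih =>
    by_cases hne : w = revPerm n
    · exact hne ▸ top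
    obtain ⟨i, hi, hlt⟩ := exists_ascent_of_ne_revPerm hw hne
    have hd : (w * sTr i) (i + 1) < (w * sTr i) i := by
      rwa [mul_sTr_apply_left, mul_sTr_apply_right]
    have h1 := inv_mul_sTr hi hd
    rw [mul_sTr_mul_sTr] at h1
    have h2 := inv_le (n := n) (w := w * sTr i)
    have := step _ i (hw.mul_sTr hi) hi hd (ih _ (by omega) (hw.mul_sTr hi) rfl)
    rwa [mul_sTr_mul_sTr] at this

theorem exists_descent_of_ne_one {w : Equiv.Perm ℕ} (hne : w ≠ 1) :
    ∃ i, w (i + 1) < w i := by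
  by_contra! h
  have hm : StrictMono w := (monotone_nat_of_le_succ h).strictMono_of_injective w.injective
  have hm' : StrictMono ⇑w⁻¹ := fun a b hab => by
    by_contra! hle
    have := hm.monotone hle
    simp at this
    omega
  refine hne (Equiv.ext fun j => le_antisymm ?_ (hm.id_le j))
  have := hm'.id_le (w j)
  simpa using this

theorem rel_of_forall_rel_succ_below {r : ℕ → ℕ → Prop} [IsTrans ℕ r] {f : ℕ → ℕ} {a b : ℕ}
    (h : ∀ j < b, r (f j) (f (j + 1))) (hab : a < b) : r (f a) (f b) := by
  induction b, Nat.succ_le_of_lt hab using Nat.le_induction with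
  | base => exact h a (by omega)
  | succ b hb ih =>
    exact _root_.trans (ih (fun j hj => h j (by omega)) hb) (h b (by omega))

/-- `IsDescentWord w l` says that `l` lists positions at which descents are removed
successively from `w`, ending at the identity. -/
def IsDescentWord : Equiv.Perm ℕ → List ℕ → Prop
  | w, [] => w = 1
  | w, i :: l => w (i + 1) < w i ∧ IsDescentWord (w * sTr i) l

theorem IsDescentWord.unique {w w' : Equiv.Perm ℕ} {l : List ℕ} (h : IsDescentWord w l)
    (h' : IsDescentWord w' l) : w = w' := by
  induction l generalizing w w' with
  | nil => exact Eq.trans h (Eq.symm h')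
  | cons i l ih => exact mul_right_cancel (ih h.2 h'.2)

/-! ### Double Schubert polynomials -/

section Schubert

variable {K : Type*} [Field K] {S : (ℕ → K) → Equiv.Perm ℕ → MvPolynomial ℕ K}

theorem GrothFamily.revPerm_eq (hS : GrothFamily (0 : K) S) (t : ℕ → K) (n : ℕ) :
    S t (revPerm n)
      = ∏ i ∈ Finset.range n, ∏ j ∈ Finset.range (n - 1 - i), (X i - C (t j)) := by
  simpa using (hS t (by simp)).1 n

theorem GrothFamily.ddiff_of_descent (hS : GrothFamily (0 : K) S) (t : ℕ → K)
    {w : Equiv.Perm ℕ} {i : ℕ} (hi : w (i + 1) < w i) :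
    ddiff i (S t w) = S t (w * sTr i) :=
  ddiff_eq (by simpa using (hS t (by simp)).2 w i hi)

theorem GrothFamily.ddiff_of_ascent (hS : GrothFamily (0 : K) S) (t : ℕ → K)
    {w : Equiv.Perm ℕ} {i : ℕ} (hi : w i < w (i + 1)) : ddiff i (S t w) = 0 := by
  have h := hS.ddiff_of_descent t (w := w * sTr i) (i := i)
    (by rwa [mul_sTr_apply_left, mul_sTr_apply_right])
  rw [mul_sTr_mul_sTr] at h
  rw [← h, ddiff_ddiff]

theorem GrothFamily.one (hS : GrothFamily (0 : K) S) (t : ℕ → K) : S t 1 = 1 := by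
  have h : revPerm 0 = 1 := Equiv.ext fun j => revPerm_inSn 0 j j.zero_le
  simpa [h] using hS.revPerm_eq t 0

/-- Each `𝔖_w(x, t)` is the specialization of a polynomial with polynomial coefficients in
generic `t`, which vanishes at all points `x = σ t` with `σ ≠ w` not longer than `w`. -/
theorem GrothFamily.exists_generic (hS : GrothFamily (0 : K) S) {n : ℕ} {w : Equiv.Perm ℕ}
    (hw : InSn n w) : ∃ P : MvPolynomial ℕ (MvPolynomial ℕ K),
      (∀ t : ℕ → K, MvPolynomial.map (eval t) P = S t w) ∧
      ∀ σ : Equiv.Perm ℕ, InSn n σ → inv n σ ≤ inv n w → σ ≠ w →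
        eval (fun j => (X (σ j) : MvPolynomial ℕ K)) P = 0 := by
  refine InSn.induction (motive := fun w => ∃ P : MvPolynomial ℕ (MvPolynomial ℕ K),
      (∀ t : ℕ → K, MvPolynomial.map (eval t) P = S t w) ∧
      ∀ σ : Equiv.Perm ℕ, InSn n σ → inv n σ ≤ inv n w → σ ≠ w →
        eval (fun j => (X (σ j) : MvPolynomial ℕ K)) P = 0) ?_ ?_ hw
  · refine ⟨∏ i ∈ Finset.range n, ∏ j ∈ Finset.range (n - 1 - i), (X i - C (X j)),
      fun t => ?_, fun σ hσ _ hne => ?_⟩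
    · simp [hS.revPerm_eq, map_prod]
    · obtain ⟨i, hi, hlt⟩ : ∃ i < n, σ i < n - 1 - i := by
        by_contra! h
        exact hne (eq_revPerm_of_le hσ h)
      rw [map_prod]
      refine Finset.prod_eq_zero (Finset.mem_range.2 hi) ?_
      rw [map_prod]
      refine Finset.prod_eq_zero (Finset.mem_range.2 hlt) ?_
      simp
  · rintro w i hw hi hd ⟨P, hP, hvan⟩
    refine ⟨ddiff i P, fun t => ?_, fun σ hσ hlen hne => ?_⟩
    · rw [map_ddiff, hP, hS.ddiff_of_descent t hd]
    · have h1 := inv_mul_sTr hi hd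
      have h2 : inv n (σ * sTr i) ≤ inv n σ + 1 := inv_mul_sTr_le hi
      have h3 := eval_ddiff i (fun j => (X (σ j) : MvPolynomial ℕ K)) P
      have h4 := hvan (σ * sTr i) (hσ.mul_sTr hi) (by omega) (by
        rintro rfl; exact hne (mul_sTr_mul_sTr σ i).symm)
      have h5 := hvan σ hσ (by omega) (by rintro rfl; omega)
      have h6 : (fun j => (X (σ j) : MvPolynomial ℕ K)) ∘ ⇑(Equiv.swap i (i + 1))
        = fun j => X ((σ * sTr i) j) := rfl
      rw [h6, h4, h5, sub_zero] at h3
      refine (mul_eq_zero.1 h3).resolve_left (sub_ne_zero.2 fun h => ?_)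
      exact absurd (σ.injective (X_injective h)) i.succ_ne_self.symm

theorem GrothFamily.eval_self (hS : GrothFamily (0 : K) S) (t : ℕ → K) {w : Equiv.Perm ℕ}
    (hw : FinPerm w) (hne : w ≠ 1) : eval t (S t w) = 0 := by
  obtain ⟨n, hw⟩ := hw
  obtain ⟨P, hP, hvan⟩ := hS.exists_generic (n := n) hw
  have h := hvan 1 (InSn.one n) (by simp [inv_one]) hne.symm
  have h' (P) : eval t (MvPolynomial.map (eval t) P)
      = eval t (eval (fun j => (X j : MvPolynomial ℕ K)) P) := by
    induction P using MvPolynomial.induction_on with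
    | C a => simp
    | add p q hp hq => simp only [map_add, hp, hq]
    | mul_X p j hp => simp only [map_mul, hp, map_X, eval_X]
  rw [← hP, h']
  exact (congrArg (eval t) h).trans (map_zero _)

theorem FinPerm.mul_sTr {w : Equiv.Perm ℕ} (hw : FinPerm w) (i : ℕ) : FinPerm (w * sTr i) := by
  obtain ⟨n, hn⟩ := hw
  exact ⟨n + i + 2, InSn.mul_sTr (InSn.mono (by omega) hn) (by omega)⟩

open Classical in
theorem GrothFamily.eval_ddiffList (hS : GrothFamily (0 : K) S) (t : ℕ → K) (l : List ℕ)
    {w : Equiv.Perm ℕ} (hw : FinPerm w) :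
    eval t (ddiffList l (S t w)) = if IsDescentWord w l then 1 else 0 := by
  induction l generalizing w with
  | nil =>
    by_cases h : w = 1
    · simp [ddiffList, IsDescentWord, h, hS.one]
    · simp [ddiffList, IsDescentWord, h, hS.eval_self t hw h]
  | cons i l ih =>
    rw [ddiffList_cons]
    by_cases h : w (i + 1) < w i
    · rw [hS.ddiff_of_descent t h, ih (hw.mul_sTr i)]
      simp [IsDescentWord, h]
    · have hne : w i ≠ w (i + 1) := fun e => absurd (w.injective e) i.succ_ne_self.symm
      rw [hS.ddiff_of_ascent t (lt_of_le_of_ne (not_lt.1 h) hne)]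
      simp [IsDescentWord, h]

/-- The `K`-span of the double Schubert polynomials `𝔖_w(x, t)` for `w ∈ S_∞`. -/
def schubertSpan (S : (ℕ → K) → Equiv.Perm ℕ → MvPolynomial ℕ K) (t : ℕ → K) :
    Submodule K (MvPolynomial ℕ K) := Submodule.span K (S t '' {w | FinPerm w})

theorem schubertSpan_subset {t : ℕ → K} {w : Equiv.Perm ℕ} (hw : FinPerm w) :
    S t w ∈ schubertSpan S t := Submodule.subset_span ⟨w, hw, rfl⟩

theorem GrothFamily.ddiff_mem_schubertSpan (hS : GrothFamily (0 : K) S) {t : ℕ → K} (i : ℕ)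
    {f : MvPolynomial ℕ K} (hf : f ∈ schubertSpan S t) : ddiff i f ∈ schubertSpan S t := by
  refine Submodule.span_induction (p := fun f _ => ddiff i f ∈ schubertSpan S t)
    ?_ ?_ ?_ ?_ hf
  · rintro _ ⟨w, hw, rfl⟩
    by_cases h : w (i + 1) < w i
    · rw [hS.ddiff_of_descent t h]
      exact schubertSpan_subset (hw.mul_sTr i)
    · have hne : w i ≠ w (i + 1) := fun e => absurd (w.injective e) i.succ_ne_self.symm
      rw [hS.ddiff_of_ascent t (lt_of_le_of_ne (not_lt.1 h) hne)]
      exact zero_mem _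
  · simp
  · intro f g _ _ hf hg
    rw [map_add]; exact add_mem hf hg
  · intro a f _ hf
    rw [map_smul]; exact Submodule.smul_mem _ a hf

/-- On the span of the double Schubert polynomials, the functional `f ↦ (∂_l f)(t)` only
depends on which permutation `l` is a descent word of. -/
theorem GrothFamily.eval_ddiffList_congr (hS : GrothFamily (0 : K) S) {t : ℕ → K} {l l' : List ℕ}
    (h : ∀ w, IsDescentWord w l ↔ IsDescentWord w l') {f : MvPolynomial ℕ K}
    (hf : f ∈ schubertSpan S t) : eval t (ddiffList l f) = eval t (ddiffList l' f) := by
  refine Submodule.span_induction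
    (p := fun f _ => eval t (ddiffList l f) = eval t (ddiffList l' f)) ?_ ?_ ?_ ?_ hf
  · rintro _ ⟨w, hw, rfl⟩
    classical
    rw [hS.eval_ddiffList t l hw, hS.eval_ddiffList t l' hw]
    simp only [h]
  · simp
  · intro f g _ _ hf hg
    simp [hf, hg]
  · intro a f _ hf
    simp [smul_eval, hf]

theorem GrothFamily.eval_ddiffList_eq_zero (hS : GrothFamily (0 : K) S) {t : ℕ → K} {l : List ℕ}
    (h : ∀ w, ¬ IsDescentWord w l) {f : MvPolynomial ℕ K}
    (hf : f ∈ schubertSpan S t) : eval t (ddiffList l f) = 0 := by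
  refine Submodule.span_induction (p := fun f _ => eval t (ddiffList l f) = 0) ?_ ?_ ?_ ?_ hf
  · rintro _ ⟨w, hw, rfl⟩
    classical
    rw [hS.eval_ddiffList t l hw, if_neg (h w)]
  · simp
  · intro f g _ _ hf hg
    simp [hf, hg]
  · intro a f _ hf
    simp [smul_eval, hf]

/-! ### Dominant permutations -/

theorem code_revPerm {n p : ℕ} (hp : p < n) : code n (revPerm n) p = n - 1 - p := by
  have : ((Finset.range n).filter fun q => p < q ∧ revPerm n q < revPerm n p)
      = Finset.Ioo p n := by
    ext q
    simp only [Finset.mem_filter, Finset.mem_range, Finset.mem_Ioo]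
    constructor
    · rintro ⟨h1, h2, -⟩; exact ⟨h2, h1⟩
    · rintro ⟨h1, h2⟩
      rw [revPerm_apply h2, revPerm_apply hp]
      omega
  rw [code, this, Nat.card_Ioo]
  omega

theorem rename_prod_X_pow_swap {i n : ℕ} (hi : i + 1 < n) {c : ℕ → ℕ} (hc : c i = c (i + 1)) :
    rename ⇑(Equiv.swap i (i + 1)) (∏ p ∈ Finset.range n, (X p : MvPolynomial ℕ K) ^ c p)
      = ∏ p ∈ Finset.range n, X p ^ c p := by
  rw [map_prod]
  have hmem : ∀ p, p ∈ Finset.range n ↔ Equiv.swap i (i + 1) p ∈ Finset.range n := by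
    intro p
    rcases eq_or_ne p i with rfl | h1
    · simp only [Equiv.swap_apply_left, Finset.mem_range]; omega
    rcases eq_or_ne p (i + 1) with rfl | h2
    · simp only [Equiv.swap_apply_right, Finset.mem_range]; omega
    · rw [Equiv.swap_apply_of_ne_of_ne h1 h2]
  refine Finset.prod_equiv (Equiv.swap i (i + 1)) hmem fun p _ => ?_
  rw [map_pow, rename_X]
  congr 1
  rcases eq_or_ne p i with rfl | h1
  · rw [Equiv.swap_apply_left, hc]
  rcases eq_or_ne p (i + 1) with rfl | h2
  · rw [Equiv.swap_apply_right, hc]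
  · rw [Equiv.swap_apply_of_ne_of_ne h1 h2]

theorem ddiff_one (i : ℕ) : ddiff i (1 : MvPolynomial ℕ K) = 0 := ddiff_eq (by simp)

/-- For a dominant (`132`-avoiding) permutation the Schubert polynomial is a monomial. -/
theorem GrothFamily.eq_monomial_of_dominant (hS : GrothFamily (0 : K) S) {n : ℕ}
    {w : Equiv.Perm ℕ} (hw : InSn n w)
    (hdom : ∀ a b c, a < b → b < c → ¬ (w a < w c ∧ w c < w b)) :
    S (fun _ => 0) w = ∏ p ∈ Finset.range n, X p ^ code n w p := by
  induction hm : n * n - inv n w using Nat.strong_induction_on generalizing w with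
  | _ m ih =>
    by_cases hne : w = revPerm n
    · subst hne
      rw [hS.revPerm_eq]
      refine Finset.prod_congr rfl fun p hp => ?_
      simp [code_revPerm (Finset.mem_range.1 hp)]
    have hex := exists_ascent_of_ne_revPerm hw hne
    classical
    obtain ⟨hi, hlt⟩ := Nat.find_spec hex
    have hmin := fun j hj => Nat.find_min hex (m := j) hj
    generalize Nat.find hex = i at hi hlt hmin
    have hdec : ∀ p, p < i → w i < w p := fun p hp =>
      rel_of_forall_rel_succ_below (r := (· > ·)) (fun j hj => by
        have h1 : w j ≠ w (j + 1) := fun e => absurd (w.injective e) j.succ_ne_self.symm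
        have h2 : ¬ w j < w (j + 1) := fun h => hmin j hj ⟨by omega, h⟩
        exact lt_of_le_of_ne (not_lt.1 h2) h1.symm) hp
    have hd : (w * sTr i) (i + 1) < (w * sTr i) i := by
      rwa [mul_sTr_apply_left, mul_sTr_apply_right]
    have hinv := inv_mul_sTr hi hd
    have hleft := code_mul_sTr_left (n := n) hd
    have hright := code_mul_sTr_right hi hd
    have hother := fun p => code_mul_sTr_of_ne (w := w * sTr i) hi (p := p)
    rw [mul_sTr_mul_sTr] at hinv hleft hright
    simp only [mul_sTr_mul_sTr] at hother
    have hle := inv_le (n := n) (w := w * sTr i)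
    have hcode : code n w i = code n w (i + 1) := by
      unfold code
      congr 1
      ext q
      simp only [Finset.mem_filter, Finset.mem_range]
      constructor
      · rintro ⟨h1, h2, h3⟩
        have : q ≠ i + 1 := by rintro rfl; omega
        omega
      · rintro ⟨h1, h2, h3⟩
        have h4 := hdom i (i + 1) q (by omega) h2
        have h5 : w q ≠ w i := fun e => by have := w.injective e; omega
        omega
    have hdom' : ∀ a b c, a < b → b < c →
        ¬ ((w * sTr i) a < (w * sTr i) c ∧ (w * sTr i) c < (w * sTr i) b) := by
      intro a b c hab hbc ⟨h1, h2⟩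
      have hval : ∀ j, (j = i ∧ (w * sTr i) j = w (i + 1)) ∨
          (j = i + 1 ∧ (w * sTr i) j = w i) ∨
          (j ≠ i ∧ j ≠ i + 1 ∧ (w * sTr i) j = w j) := by
        intro j
        rcases eq_or_ne j i with rfl | h1
        · exact Or.inl ⟨rfl, mul_sTr_apply_left w j⟩
        rcases eq_or_ne j (i + 1) with rfl | h2
        · exact Or.inr (Or.inl ⟨rfl, mul_sTr_apply_right w i⟩)
        · exact Or.inr (Or.inr ⟨h1, h2, mul_sTr_apply_of_ne w h1 h2⟩)
      rcases hval a with ⟨ha, ea⟩ | ⟨ha, ea⟩ | ⟨ha, ha', ea⟩ <;>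
      rcases hval b with ⟨hb, eb⟩ | ⟨hb, eb⟩ | ⟨hb, hb', eb⟩ <;>
      rcases hval c with ⟨hc, ec⟩ | ⟨hc, ec⟩ | ⟨hc, hc', ec⟩ <;>
      rw [ea, ec] at h1 <;> rw [ec, eb] at h2 <;> first
        | omega
        | exact hdom _ _ _ (by omega) (by omega) ⟨h1, h2⟩
        | exact absurd h1 (hdec a (by omega)).not_gt
    have hS' := ih _ (by omega) (hw.mul_sTr hi) hdom' rfl
    have hprod : ∏ p ∈ Finset.range n, (X p : MvPolynomial ℕ K) ^ code n (w * sTr i) p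
        = X i * ∏ p ∈ Finset.range n, X p ^ code n w p := by
      rw [← Finset.mul_prod_erase _ _ (Finset.mem_range.2 (by omega : i < n)),
        ← Finset.mul_prod_erase (Finset.range n) (fun p => X p ^ code n w p)
          (Finset.mem_range.2 (by omega : i < n)),
        ← mul_assoc, ← pow_succ', ← hright, ← hcode]
      congr 1
      refine Finset.prod_congr rfl fun p hp => ?_
      have hpi := (Finset.mem_erase.1 hp).1
      rcases eq_or_ne p (i + 1) with rfl | h2
      · rw [← hleft, hcode]
      · rw [hother p hpi h2]
    have hsymm := rename_prod_X_pow_swap (K := K) hi hcode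
    have hdd := hS.ddiff_of_descent (fun _ => 0) hd
    rw [mul_sTr_mul_sTr, hS', hprod, ddiff_X_mul] at hdd
    have hzero := ddiff_mul_of_rename_eq hsymm 1
    rw [mul_one, ddiff_one, mul_zero] at hzero
    rw [← hdd, hzero, mul_zero, add_zero]

/-- The cycle `2 3 ⋯ k+1 1`. -/
def cyclePerm (k : ℕ) : Equiv.Perm ℕ where
  toFun j := if j < k then j + 1 else if j = k then 0 else j
  invFun j := if j = 0 then k else if j ≤ k then j - 1 else j
  left_inv j := by grind
  right_inv j := by grind

theorem cyclePerm_apply (k j : ℕ) :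
    cyclePerm k j = if j < k then j + 1 else if j = k then 0 else j := rfl

theorem cyclePerm_inSn (k : ℕ) : InSn (k + 1) (cyclePerm k) := fun j hj => by
  rw [cyclePerm_apply, if_neg (by omega), if_neg (by omega)]

theorem GrothFamily.cyclePerm_eq (hS : GrothFamily (0 : K) S) (k : ℕ) :
    S (fun _ => 0) (cyclePerm k) = ∏ p ∈ Finset.range k, X p := by
  rw [hS.eq_monomial_of_dominant (cyclePerm_inSn k), Finset.prod_range_succ]
  · have hk : code (k + 1) (cyclePerm k) k = 0 := by
      refine Finset.card_eq_zero.2 (Finset.filter_eq_empty_iff.2 fun q hq => ?_)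
      rw [Finset.mem_range] at hq
      omega
    rw [hk, pow_zero, mul_one]
    refine Finset.prod_congr rfl fun p hp => ?_
    rw [Finset.mem_range] at hp
    have : ((Finset.range (k + 1)).filter fun q => p < q ∧ cyclePerm k q < cyclePerm k p)
        = {k} := by
      ext q
      rw [Finset.mem_filter, Finset.mem_range, Finset.mem_singleton, cyclePerm_apply,
        cyclePerm_apply]
      split_ifs <;> omega
    rw [code, this, Finset.card_singleton, pow_one]
  · intro a b c hab hbc
    simp only [cyclePerm_apply]
    split_ifs <;> omega

/-! ### Positivity -/

/-- A function of a valuation `t` given by a polynomial with coefficients in `ℕ`. -/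
def IsNatPoly (g : (ℕ → K) → K) : Prop :=
  ∃ p : MvPolynomial ℕ ℕ, ∀ t, g t = eval t (MvPolynomial.map (Nat.castRingHom K) p)

theorem IsNatPoly.zero : IsNatPoly fun _ => (0 : K) := ⟨0, by simp⟩

theorem IsNatPoly.one : IsNatPoly fun _ => (1 : K) := ⟨1, by simp⟩

theorem IsNatPoly.add {g h : (ℕ → K) → K} (hg : IsNatPoly g) (hh : IsNatPoly h) :
    IsNatPoly fun t => g t + h t := by
  obtain ⟨p, hp⟩ := hg
  obtain ⟨q, hq⟩ := hh
  exact ⟨p + q, fun t => by simp [hp, hq]⟩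

theorem IsNatPoly.prod_mul {g : (ℕ → K) → K} (hg : IsNatPoly g) (I : Finset ℕ) :
    IsNatPoly fun t => (∏ p ∈ I, t p) * g t := by
  obtain ⟨p, hp⟩ := hg
  exact ⟨(∏ p ∈ I, X p) * p, fun t => by simp [hp, map_prod]⟩

/-- All values `(∂_l F)(t)` at `x = t` are polynomials in `t` with coefficients in `ℕ`. -/
def HasPosDiffs (F : (ℕ → K) → MvPolynomial ℕ K) : Prop :=
  ∀ l : List ℕ, IsNatPoly fun t => eval t (ddiffList l (F t))

theorem HasPosDiffs.map_ddiff {F : (ℕ → K) → MvPolynomial ℕ K} (hF : HasPosDiffs F) (i : ℕ) :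
    HasPosDiffs fun t => ddiff i (F t) := fun l => hF (i :: l)

theorem ddiff_prod_X_mul_of_iff {I : Finset ℕ} {i : ℕ} (h : i ∈ I ↔ i + 1 ∈ I)
    (f : MvPolynomial ℕ K) :
    ddiff i ((∏ p ∈ I, X p) * f) = (∏ p ∈ I, X p) * ddiff i f := by
  refine ddiff_mul_of_rename_eq ?_ f
  rw [map_prod]
  refine Finset.prod_equiv (Equiv.swap i (i + 1)) (fun p => ?_) fun p _ => rename_X _ _
  rcases eq_or_ne p i with rfl | h1
  · rw [Equiv.swap_apply_left, h]
  rcases eq_or_ne p (i + 1) with rfl | h2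
  · rw [Equiv.swap_apply_right, h]
  · rw [Equiv.swap_apply_of_ne_of_ne h1 h2]

theorem ddiff_prod_X_mul_of_mem {I : Finset ℕ} {i : ℕ} (h : i ∈ I) (h' : i + 1 ∉ I)
    (f : MvPolynomial ℕ K) :
    ddiff i ((∏ p ∈ I, X p) * f)
      = (∏ p ∈ I.erase i, X p) * f + (∏ p ∈ insert (i + 1) (I.erase i), X p) * ddiff i f := by
  have h1 : i + 1 ∉ I.erase i := fun hm => h' (Finset.mem_of_mem_erase hm)
  rw [← Finset.mul_prod_erase I _ h, mul_assoc, mul_left_comm,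
    ddiff_prod_X_mul_of_iff (iff_of_false (Finset.notMem_erase i I) h1), ddiff_X_mul,
    Finset.prod_insert h1]
  ring

/-- Removing the first descent of `w` at each step yields a descent word along which a product
of distinct variables, indexed by a set `I` each of whose elements preceded by a gap is a
left-to-right maximum position of `w`, can be moved past the divided differences positively. -/
theorem exists_isDescentWord_prod_X_mul {n : ℕ} {w : Equiv.Perm ℕ} (hw : InSn n w) :
    ∃ l, IsDescentWord w l ∧ ∀ I : Finset ℕ,
      (∀ b ∈ I, ∀ c < b, c ∉ I → ∀ a < b, w a < w b) →
      ∀ F : (ℕ → K) → MvPolynomial ℕ K, HasPosDiffs F →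
        IsNatPoly fun t => eval t (ddiffList l ((∏ p ∈ I, X p) * F t)) := by
  induction hm : inv n w using Nat.strong_induction_on generalizing w with
  | _ m ih =>
    by_cases hne : w = 1
    · refine ⟨[], hne, fun I _ F hF => ?_⟩
      simpa [ddiffList, map_prod] using (hF []).prod_mul I
    have hex := exists_descent_of_ne_one hne
    classical
    have hi := Nat.find_spec hex
    have hmin := fun j hj => Nat.find_min hex (m := j) hj
    generalize Nat.find hex = i at hi hmin
    have hinc : ∀ a, a < i → w a < w i := fun a ha =>
      rel_of_forall_rel_succ_below (r := (· < ·)) (fun j hj => by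
        have h1 : w j ≠ w (j + 1) := fun e => absurd (w.injective e) j.succ_ne_self.symm
        exact lt_of_le_of_ne (not_lt.1 (hmin j hj)) h1) ha
    have hin := hw.lt_of_descent hi
    have hinv := inv_mul_sTr hin hi
    obtain ⟨l, hl, hpos⟩ := ih _ (by omega) (hw.mul_sTr hin) rfl
    have hlt : ∀ b, i + 1 < b → (∀ a < b, w a < w b) → ∀ a < b, (w * sTr i) a < (w * sTr i) b := by
      intro b hb h a ha
      rw [mul_sTr_apply_of_ne w (by omega) (by omega) (j := b)]
      rcases eq_or_ne a i with rfl | h1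
      · rw [mul_sTr_apply_left]; exact h _ hb
      rcases eq_or_ne a (i + 1) with rfl | h2
      · rw [mul_sTr_apply_right]; exact h _ (by omega)
      · rw [mul_sTr_apply_of_ne w h1 h2]; exact h _ ha
    have hlt' : ∀ b, b < i → (∀ a < b, w a < w b) → ∀ a < b, (w * sTr i) a < (w * sTr i) b := by
      intro b hb h a ha
      rw [mul_sTr_apply_of_ne w (by omega) (by omega) (j := b),
        mul_sTr_apply_of_ne w (by omega) (by omega)]
      exact h a ha
    refine ⟨i :: l, ⟨hi, hl⟩, fun I hI F hF => ?_⟩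
    simp only [ddiffList_cons]
    have hsucc : i + 1 ∈ I → ∀ c < i + 1, c ∈ I := fun h c hc => by
      by_contra hcI
      exact absurd (hI _ h c hc hcI i (by omega)) hi.not_gt
    by_cases h2 : i + 1 ∈ I
    · have h1 : i ∈ I := hsucc h2 i (by omega)
      simp only [ddiff_prod_X_mul_of_iff (iff_of_true h1 h2)]
      refine hpos I (fun b hb c hcb hc => ?_) _ (hF.map_ddiff i)
      rcases lt_or_ge (i + 1) b with h3 | h3
      · exact hlt b h3 (hI b hb c hcb hc)
      · exact absurd (hsucc h2 c (by omega)) hc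
    by_cases h1 : i ∈ I
    · simp only [ddiff_prod_X_mul_of_mem h1 h2, map_add]
      refine (hpos _ (fun b hb c hcb hc => ?_) _ hF).add
        (hpos _ (fun b hb c hcb hc => ?_) _ (hF.map_ddiff i))
      · have hbI := Finset.mem_of_mem_erase hb
        have hbi := Finset.ne_of_mem_erase hb
        have hbi' : b ≠ i + 1 := by rintro rfl; exact h2 hbI
        rcases lt_or_ge (i + 1) b with h3 | h3
        · exact hlt b h3 (hI b hbI (i + 1) h3 h2)
        · refine hlt' b (by omega) (hI b hbI c hcb fun hcI => hc ?_)
          exact Finset.mem_erase.2 ⟨by omega, hcI⟩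
      · rcases Finset.mem_insert.1 hb with rfl | hb
        · intro a ha
          rw [mul_sTr_apply_right]
          rcases eq_or_ne a i with rfl | h4
          · rwa [mul_sTr_apply_left]
          · rw [mul_sTr_apply_of_ne w h4 (by omega)]; exact hinc a (by omega)
        have hbI := Finset.mem_of_mem_erase hb
        have hbi := Finset.ne_of_mem_erase hb
        have hbi' : b ≠ i + 1 := by rintro rfl; exact h2 hbI
        rcases lt_or_ge (i + 1) b with h3 | h3
        · exact hlt b h3 (hI b hbI (i + 1) h3 h2)
        · refine hlt' b (by omega) (hI b hbI c hcb fun hcI => hc ?_)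
          exact Finset.mem_insert_of_mem (Finset.mem_erase.2 ⟨by omega, hcI⟩)
    · simp only [ddiff_prod_X_mul_of_iff (iff_of_false h1 h2)]
      refine hpos I (fun b hb c hcb hc => ?_) _ (hF.map_ddiff i)
      have hbi : b ≠ i := by rintro rfl; exact h1 hb
      have hbi' : b ≠ i + 1 := by rintro rfl; exact h2 hb
      rcases lt_or_ge (i + 1) b with h3 | h3
      · exact hlt b h3 (hI b hb c hcb hc)
      · exact hlt' b (by omega) (hI b hb c hcb hc)

theorem IsDescentWord.finPerm {w : Equiv.Perm ℕ} {l : List ℕ} (h : IsDescentWord w l) :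
    FinPerm w := by
  induction l generalizing w with
  | nil => exact ⟨0, fun j _ => by rw [show w = 1 from h]; rfl⟩
  | cons i l ih =>
    have := (ih h.2).mul_sTr i
    rwa [mul_sTr_mul_sTr] at this

/-- Families `F` in the span of the double Schubert polynomials whose coefficients are
polynomials in `t` with coefficients in `ℕ`. -/
def IsSchubertPos (S : (ℕ → K) → Equiv.Perm ℕ → MvPolynomial ℕ K)
    (F : (ℕ → K) → MvPolynomial ℕ K) : Prop :=
  (∀ t, F t ∈ schubertSpan S t) ∧ HasPosDiffs F

variable {cbar : (ℕ → K) → (ℕ → K) → Equiv.Perm ℕ → Equiv.Perm ℕ → Equiv.Perm ℕ → K}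

theorem StructConsts.mul_mem_schubertSpan (hc : StructConsts (0 : K) S cbar) (t y : ℕ → K)
    {u v : Equiv.Perm ℕ} (hu : FinPerm u) (hv : FinPerm v) :
    S y u * S t v ∈ schubertSpan S t := by
  obtain ⟨-, hfin, heq⟩ := hc t y (by simp) (by simp) u v hu hv
  rw [heq]
  refine finsum_induction (· ∈ schubertSpan S t) (zero_mem _) (fun _ _ => add_mem) fun w => ?_
  by_cases hw : FinPerm w
  · rw [← smul_eq_C_mul]
    exact Submodule.smul_mem _ _ (schubertSpan_subset hw)
  · simp [hfin w hw]

theorem IsSchubertPos.of_schubert (hS : GrothFamily (0 : K) S) {v : Equiv.Perm ℕ}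
    (hv : FinPerm v) : IsSchubertPos S fun t => S t v := by
  refine ⟨fun t => schubertSpan_subset hv, fun l => ?_⟩
  classical
  simp only [hS.eval_ddiffList _ l hv]
  split_ifs
  exacts [IsNatPoly.one, IsNatPoly.zero]

theorem IsSchubertPos.map_ddiff (hS : GrothFamily (0 : K) S) {F : (ℕ → K) → MvPolynomial ℕ K}
    (hF : IsSchubertPos S F) (i : ℕ) : IsSchubertPos S fun t => ddiff i (F t) :=
  ⟨fun t => hS.ddiff_mem_schubertSpan i (hF.1 t), hF.2.map_ddiff i⟩

theorem IsSchubertPos.prod_X_mul (hS : GrothFamily (0 : K) S) (hc : StructConsts (0 : K) S cbar)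
    {F : (ℕ → K) → MvPolynomial ℕ K} (hF : IsSchubertPos S F) (k : ℕ) :
    IsSchubertPos S fun t => (∏ p ∈ Finset.range k, X p) * F t := by
  have hmem : ∀ t, (∏ p ∈ Finset.range k, X p) * F t ∈ schubertSpan S t := fun t => by
    refine Submodule.span_induction
      (p := fun f _ => (∏ p ∈ Finset.range k, X p) * f ∈ schubertSpan S t) ?_ ?_ ?_ ?_ (hF.1 t)
    · rintro _ ⟨w, hw, rfl⟩
      rw [← hS.cyclePerm_eq]
      exact hc.mul_mem_schubertSpan t _ ⟨k + 1, cyclePerm_inSn k⟩ hw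
    · simp
    · intro f g _ _ hf hg
      rw [mul_add]; exact add_mem hf hg
    · intro a f _ hf
      rw [mul_smul_comm]; exact Submodule.smul_mem _ a hf
  refine ⟨hmem, fun l => ?_⟩
  by_cases hl : ∃ w, IsDescentWord w l
  · obtain ⟨w, hw⟩ := hl
    obtain ⟨n, hn⟩ := hw.finPerm
    obtain ⟨l', hw', hpos⟩ := exists_isDescentWord_prod_X_mul (K := K) (n := n) hn
    have hiff : ∀ w', IsDescentWord w' l ↔ IsDescentWord w' l' := fun w' =>
      ⟨fun h => h.unique hw ▸ hw', fun h => h.unique hw' ▸ hw⟩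
    simp only [fun t => hS.eval_ddiffList_congr hiff (hmem t)]
    refine hpos _ (fun b hb c hcb hc => absurd ?_ hc) F hF.2
    rw [Finset.mem_range] at hb ⊢
    omega
  · push Not at hl
    simp only [fun t => hS.eval_ddiffList_eq_zero hl (hmem t)]
    exact IsNatPoly.zero

theorem IsSchubertPos.prod_X_pow_mul (hS : GrothFamily (0 : K) S)
    (hc : StructConsts (0 : K) S cbar) {F : (ℕ → K) → MvPolynomial ℕ K}
    (hF : IsSchubertPos S F) (k : ℕ) (c : ℕ → ℕ) (hanti : ∀ i, i + 1 < k → c (i + 1) ≤ c i) :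
    IsSchubertPos S fun t => (∏ p ∈ Finset.range k, X p ^ c p) * F t := by
  induction k generalizing c with
  | zero => simpa using hF
  | succ k ih =>
    have hle : ∀ p ∈ Finset.range k, c k ≤ c p := fun p hp => by
      rw [Finset.mem_range] at hp
      have : ∀ m, p ≤ m → m ≤ k → c m ≤ c p := fun m hpm => by
        induction m, hpm using Nat.le_induction with
        | base => intro _; exact le_rfl
        | succ m _ ih => intro hm; exact (hanti m (by omega)).trans (ih (by omega))
      exact this k hp.le le_rfl
    have hpow : ∀ d, IsSchubertPos S fun t =>
        (∏ p ∈ Finset.range (k + 1), X p) ^ d *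
          ((∏ p ∈ Finset.range k, X p ^ (c p - c k)) * F t) := by
      intro d
      induction d with
      | zero =>
        simpa using ih (fun p => c p - c k) fun i hi =>
          Nat.sub_le_sub_right (hanti i (by omega)) _
      | succ d ihd =>
        simpa only [pow_succ', mul_assoc] using ihd.prod_X_mul hS hc (k + 1)
    have heq : (∏ p ∈ Finset.range (k + 1), (X p : MvPolynomial ℕ K) ^ c p)
        = (∏ p ∈ Finset.range (k + 1), X p) ^ c k * ∏ p ∈ Finset.range k, X p ^ (c p - c k) := by
      rw [Finset.prod_range_succ, Finset.prod_range_succ, mul_pow, ← Finset.prod_pow,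
        mul_right_comm, ← Finset.prod_mul_distrib]
      congr 1
      refine Finset.prod_congr rfl fun p hp => ?_
      rw [← pow_add, Nat.add_sub_cancel' (hle p hp)]
    simpa only [heq, mul_assoc] using hpow (c k)

theorem IsSchubertPos.schubert_mul (hS : GrothFamily (0 : K) S) (hc : StructConsts (0 : K) S cbar)
    {n k : ℕ} (hk : k ≤ n) {u v : Equiv.Perm ℕ} (hu : InSn n u) (hv : InSn n v)
    (hsep : SepDesc k u v) : IsSchubertPos S fun t => S (fun _ => 0) u * S t v := by
  have hvsymm : ∀ i, i + 1 < k → ∀ t, rename ⇑(Equiv.swap i (i + 1)) (S t v) = S t v :=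
    fun i hi t => rename_eq_of_ddiff_eq_zero <| hS.ddiff_of_ascent t <|
      lt_of_le_of_ne (hsep.2 i hi) fun e => absurd (v.injective e) i.succ_ne_self.symm
  have husep := hsep.1
  clear hsep
  induction hm : n * n - inv n u using Nat.strong_induction_on generalizing u with
  | _ m ih =>
    by_cases hasc : ∃ i, i + 1 < k ∧ u i < u (i + 1)
    · obtain ⟨i, hi, hlt⟩ := hasc
      have hd : (u * sTr i) (i + 1) < (u * sTr i) i := by
        rwa [mul_sTr_apply_left, mul_sTr_apply_right]
      have h1 := inv_mul_sTr (n := n) (by omega) hd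
      rw [mul_sTr_mul_sTr] at h1
      have h2 := inv_le (n := n) (w := u * sTr i)
      have h3 := (ih (n * n - inv n (u * sTr i)) (by omega) (hu.mul_sTr (by omega)) (fun j hj => by
        rw [mul_sTr_apply_of_ne u (by omega) (by omega),
          mul_sTr_apply_of_ne u (by omega) (by omega)]
        exact husep j hj) rfl).map_ddiff hS i
      have h4 := hS.ddiff_of_descent (fun _ => 0) hd
      rw [mul_sTr_mul_sTr] at h4
      have h5 : ∀ t, ddiff i (S (fun _ => 0) (u * sTr i) * S t v) = S (fun _ => 0) u * S t v :=
        fun t => by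
          rw [mul_comm, ddiff_mul_of_rename_eq (hvsymm i hi t), h4, mul_comm]
      simpa only [h5] using h3
    push Not at hasc
    have hmono : ∀ a b, k ≤ a → a ≤ b → u a ≤ u b := fun a b ha hab => by
      induction b, hab using Nat.le_induction with
      | base => exact le_rfl
      | succ b hb ihb => exact ihb.trans (husep b (by omega))
    have hanti : ∀ a b, a ≤ b → b < k → u b ≤ u a := fun a b hab => by
      induction b, hab using Nat.le_induction with
      | base => intro _; exact le_rfl
      | succ b hb ihb => intro hbk; exact (hasc b hbk).trans (ihb (by omega))
    have hmon := hS.eq_monomial_of_dominant hu (fun a b c hab hbc ⟨h1, h2⟩ => by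
      rcases lt_or_ge b k with hb | hb
      · have := hanti a b hab.le hb; omega
      · have := hmono b c hb hbc.le; omega)
    have hzero : ∀ p, k ≤ p → code n u p = 0 := fun p hp => by
      refine Finset.card_eq_zero.2 (Finset.filter_eq_empty_iff.2 ?_)
      rintro q - ⟨h1, h2⟩
      exact absurd h2 (hmono p q hp h1.le).not_gt
    rw [hmon]
    refine (IsSchubertPos.of_schubert hS ⟨n, hv⟩).prod_X_pow_mul hS hc n _ fun i hi => ?_
    rcases lt_or_ge (i + 1) k with hik | hik
    · refine Finset.card_le_card fun q hq => ?_
      rw [Finset.mem_filter] at hq ⊢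
      have := hasc i hik
      exact ⟨hq.1, by omega, by omega⟩
    · rw [hzero _ hik]; exact Nat.zero_le _

theorem StructConsts.eq_eval_ddiffList (hS : GrothFamily (0 : K) S)
    (hc : StructConsts (0 : K) S cbar) (t y : ℕ → K) {u v w : Equiv.Perm ℕ} (hu : FinPerm u)
    (hv : FinPerm v) {l : List ℕ} (hl : IsDescentWord w l) :
    cbar t y u v w = eval t (ddiffList l (S y u * S t v)) := by
  obtain ⟨hfin, hzero, heq⟩ := hc t y (by simp) (by simp) u v hu hv
  have hsub : (Function.support fun w => C (cbar t y u v w) * S t w)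
      ⊆ (hfin.toFinset : Set (Equiv.Perm ℕ)) := fun w hw => by
    simp only [Set.Finite.coe_toFinset]
    intro h0
    exact hw (by simp [h0])
  rw [heq, finsum_eq_sum_of_support_subset _ hsub, map_sum, map_sum,
    Finset.sum_eq_single w]
  · classical
    rw [← smul_eq_C_mul, map_smul, smul_eval, hS.eval_ddiffList t l hl.finPerm, if_pos hl, mul_one]
  · intro w' _ hne
    by_cases hw' : FinPerm w'
    · classical
      rw [← smul_eq_C_mul, map_smul, smul_eval, hS.eval_ddiffList t l hw',
        if_neg fun h => hne (h.unique hl), mul_zero]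
    · simp [hzero w' hw']
  · intro hw
    have : cbar t y u v w = 0 := by simpa using hw
    simp [this]

end Schubert

/-- Corollary `Coro:SxxSxt-2` of the paper.  Let `u, v ∈ S_n`
have separated descents (at some position `k`).  Then
`𝔖_u(x)·𝔖_v(x,t) ∈ Σ_w ℤ_{≥0}[t]·𝔖_w(x,t)`:  each coefficient `c̄_{u,v}^w(t,0)`
is a polynomial in the `t`-variables with nonnegative integer coefficients,
expressed here by the existence of a polynomial with `ℕ`-coefficients whose
evaluation at every valuation `t` agrees with `c̄_{u,v}^w(t,0)`. -/
theorem schubert_times_double_schubert_positive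
    {K : Type*} [Field K] [CharZero K]
    (S : (ℕ → K) → Equiv.Perm ℕ → MvPolynomial ℕ K)
    (cbar : (ℕ → K) → (ℕ → K) → Equiv.Perm ℕ → Equiv.Perm ℕ → Equiv.Perm ℕ → K)
    (hS : GrothFamily (0 : K) S) (hc : StructConsts (0 : K) S cbar)
    (n k : ℕ) (hk : k ≤ n)
    (u v : Equiv.Perm ℕ) (hu : InSn n u) (hv : InSn n v)
    (hsep : SepDesc k u v)
    (w : Equiv.Perm ℕ) (hw : FinPerm w) :
    ∃ p : MvPolynomial ℕ ℕ, ∀ t : ℕ → K,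
      cbar t (fun _ => 0) u v w =
        MvPolynomial.eval t (MvPolynomial.map (Nat.castRingHom K) p) := by
  obtain ⟨N, hN⟩ := hw
  obtain ⟨l, hl, -⟩ := exists_isDescentWord_prod_X_mul (K := K) (n := N) hN
  obtain ⟨p, hp⟩ := (IsSchubertPos.schubert_mul hS hc hk hu hv hsep).2 l
  exact ⟨p, fun t => (hc.eq_eval_ddiffList hS t _ ⟨n, hu⟩ ⟨n, hv⟩ hl).trans (hp t)⟩
end BPDPuzzle
end
end
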